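/- arXiv:2005.00099 — 4 statements merged into one kernel-verified Lean document; each statement's English description precedes it below -/
import Mathlib

section
/- The probability that a uniformly random element of the alternating group A_n has no fixed point tends to 1/e as n → ∞; i.e. #{η ∈ A_n : η(i) ≠ i for all i ∈ {1,…,n}} / #A_n → 1/e. -/
open Finset in
theorem aux_det (n : ℕ) :
    ∑ σ : Equiv.Perm (Fin n), (if ∀ i, σ i ≠ i then ((Equiv.Perm.sign σ : ℤ)) else 0)
      = (-1) ^ n * (1 - (n : ℤ)) := by
  have h1 : (Matrix.det (-(1 + Matrix.replicateCol Unit (fun _ : Fin n => (-1 : ℤ)) *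
      Matrix.replicateRow Unit (fun _ : Fin n => (1 : ℤ))))) = (-1) ^ n * (1 - (n : ℤ)) := by
    rw [Matrix.det_neg, Matrix.det_one_add_replicateCol_mul_replicateRow]
    simp [dotProduct, sub_eq_add_neg]
  rw [← h1, Matrix.det_apply']
  refine Finset.sum_congr rfl fun σ _ => ?_
  have h2 : ∀ i j : Fin n, (-(1 + Matrix.replicateCol Unit (fun _ : Fin n => (-1 : ℤ)) *
      Matrix.replicateRow Unit (fun _ : Fin n => (1 : ℤ))) : Matrix (Fin n) (Fin n) ℤ) i j = if i ≠ j then 1 else 0 := by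
    intro i j
    by_cases h : i = j <;> simp [Matrix.mul_apply, Matrix.one_apply, h]
  simp only [h2]
  rw [Finset.prod_ite_zero]
  simp

theorem aux_card (n : ℕ) :
    2 * (Nat.card {η : alternatingGroup (Fin n) //
            ∀ i : Fin n, (η : Equiv.Perm (Fin n)) i ≠ i} : ℤ)
      = numDerangements n + (-1) ^ n * (1 - (n : ℤ)) := by
  have hc : Nat.card {η : alternatingGroup (Fin n) //
            ∀ i : Fin n, (η : Equiv.Perm (Fin n)) i ≠ i} =
      (Finset.univ.filter fun σ : Equiv.Perm (Fin n) =>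
        Equiv.Perm.sign σ = 1 ∧ ∀ i, σ i ≠ i).card := by
    rw [Nat.card_congr (Equiv.subtypeSubtypeEquivSubtypeInter
      (fun σ : Equiv.Perm (Fin n) => σ ∈ alternatingGroup (Fin n)) (fun σ => ∀ i, σ i ≠ i))]
    simp only [Equiv.Perm.mem_alternatingGroup]
    rw [Nat.card_eq_fintype_card, Fintype.card_subtype]
  have hd : numDerangements n =
      (Finset.univ.filter fun σ : Equiv.Perm (Fin n) => ∀ i, σ i ≠ i).card := by
    rw [← card_derangements_fin_eq_numDerangements, ← Fintype.card_subtype]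
    exact Fintype.card_congr (Equiv.refl _)
  rw [hc, hd, ← aux_det, Finset.card_filter, Finset.card_filter]
  push_cast
  rw [Finset.mul_sum, ← Finset.sum_add_distrib]
  refine Finset.sum_congr rfl fun σ _ => ?_
  rcases Int.units_eq_one_or (Equiv.Perm.sign σ) with h | h <;>
    by_cases h' : ∀ i, σ i ≠ i <;> simp [h, h']

/-- The probability that a uniformly random element of the alternating group `A_n`
is a derangement tends to `1/e` as `n → ∞`. -/
theorem derangement_probability_alternating :
    Filter.Tendsto (fun n : ℕ =>
        (Nat.card {η : alternatingGroup (Fin n) //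
            ∀ i : Fin n, (η : Equiv.Perm (Fin n)) i ≠ i} : ℝ)
          / (Nat.card (alternatingGroup (Fin n)) : ℝ))
      Filter.atTop (nhds (Real.exp 1)⁻¹) := by
  have hz : Filter.Tendsto (fun n : ℕ => (-1 : ℝ) ^ n * (1 - (n : ℝ)) / n.factorial)
      Filter.atTop (nhds 0) := by
    rw [← Filter.tendsto_add_atTop_iff_nat 1]
    have h0 : Filter.Tendsto (fun n : ℕ => (1 : ℝ) ^ n / n.factorial)
      Filter.atTop (nhds 0) := FloorSemiring.tendsto_pow_div_factorial_atTop 1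
    refine squeeze_zero_norm (fun n => ?_) h0
    rw [Nat.factorial_succ]
    have hf : (0 : ℝ) < n.factorial := by exact_mod_cast n.factorial_pos
    have hn : (0 : ℝ) ≤ n := n.cast_nonneg
    have e : (1 : ℝ) - ((n + 1 : ℕ) : ℝ) = -n := by push_cast; ring
    rw [e, norm_div, norm_mul, norm_pow, norm_neg, norm_neg, norm_one, one_pow, one_pow, one_mul,
      Real.norm_of_nonneg hn, Real.norm_of_nonneg (by positivity)]
    push_cast
    rw [div_le_div_iff₀ (by positivity) hf]
    nlinarith
  have := numDerangements_tendsto_inv_e.add hz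
  rw [add_zero, Real.exp_neg] at this
  refine this.congr' ?_
  filter_upwards [Filter.eventually_ge_atTop 2] with n hn
  have : Nontrivial (Fin n) := Fin.nontrivial_iff_two_le.mpr hn
  have hA : 2 * (Nat.card (alternatingGroup (Fin n)) : ℝ) = n.factorial := by
    have := two_mul_nat_card_alternatingGroup (α := Fin n)
    rw [Nat.card_perm, Nat.card_fin] at this
    exact_mod_cast this
  have hE := aux_card n
  have hE' : 2 * (Nat.card {η : alternatingGroup (Fin n) //
            ∀ i : Fin n, (η : Equiv.Perm (Fin n)) i ≠ i} : ℝ)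
      = numDerangements n + (-1) ^ n * (1 - (n : ℝ)) := by exact_mod_cast hE
  rw [← add_div, ← hE', ← hA, mul_div_mul_left _ _ two_ne_zero]
end

section
/- The probability that a uniformly random element η of the alternating group A_n is a non-identity involution (i.e. η ∘ η = id and η ≠ id, so η is a product of disjoint transpositions and 1-cycles) tends to 0 as n → ∞. -/
theorem aux_two_pow_le (m : ℕ) : 2 ^ m ≤ 2 * m.factorial := by
  induction m with
  | zero => simp
  | succ k ih =>
    rcases Nat.eq_zero_or_pos k with rfl | hk
    · simp
    · rw [pow_succ, Nat.factorial_succ]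
      nlinarith [Nat.factorial_pos k]

theorem aux_type_bound (n k : ℕ) :
    2 ^ n * (Finset.univ.filter
      (fun g : Equiv.Perm (Fin n) => g.cycleType = Multiset.replicate k 2)).card
      ≤ 4 * n.factorial := by
  have h := Equiv.Perm.card_of_cycleType_mul_eq (Fin n) (Multiset.replicate k 2)
  set c := (Finset.univ.filter
      (fun g : Equiv.Perm (Fin n) => g.cycleType = Multiset.replicate k 2)).card with hc
  have hp : (∏ j ∈ (Multiset.replicate k 2).toFinset,
      ((Multiset.replicate k 2).count j).factorial) = k.factorial := by
    rcases Nat.eq_zero_or_pos k with rfl | hk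
    · simp
    · rw [Multiset.toFinset_replicate, if_neg hk.ne']
      simp
  rw [hp] at h
  simp only [Multiset.sum_replicate, Multiset.prod_replicate, Fintype.card_fin, smul_eq_mul] at h
  split_ifs at h with hm
  · obtain ⟨m, rfl⟩ := Nat.exists_eq_add_of_le hm.1
    rw [Nat.add_sub_cancel_left] at h
    rw [← h]
    have h1 := Nat.mul_le_mul (Nat.mul_le_mul (aux_two_pow_le m) (le_refl (2 ^ k)))
      (aux_two_pow_le k)
    calc 2 ^ (k * 2 + m) * c = c * (2 ^ m * 2 ^ k * 2 ^ k) := by ring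
      _ ≤ c * (2 * m.factorial * 2 ^ k * (2 * k.factorial)) := Nat.mul_le_mul_left _ h1
      _ = _ := by ring
  · have : c = 0 := by
      rcases Nat.mul_eq_zero.mp h with h | h
      · exact h
      · have : 0 < (n - k * 2).factorial * 2 ^ k * k.factorial := by positivity
        omega
    simp [this]

theorem aux_inv_bound (n : ℕ) :
    2 ^ n * Nat.card {η : alternatingGroup (Fin n) // η * η = 1 ∧ η ≠ 1}
      ≤ 4 * (n + 1) * n.factorial := by
  classical
  let S : ℕ → Finset (Equiv.Perm (Fin n)) := fun k => Finset.univ.filter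
      (fun g : Equiv.Perm (Fin n) => g.cycleType = Multiset.replicate k 2)
  have hcard : Nat.card {η : alternatingGroup (Fin n) // η * η = 1 ∧ η ≠ 1}
      ≤ ((Finset.range (n + 1)).biUnion S).card := by
    rw [← Nat.card_eq_finsetCard]
    have hmem : ∀ η : {η : alternatingGroup (Fin n) // η * η = 1 ∧ η ≠ 1},
        ((η.1 : Equiv.Perm (Fin n))) ∈ (Finset.range (n + 1)).biUnion S := by
      rintro ⟨⟨g, hg⟩, h1, h2⟩
      have hg2 : g ^ 2 = 1 := by
        rw [pow_two]
        exact congrArg Subtype.val h1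
      have ht := Equiv.Perm.cycleType_of_pow_prime_eq_one hg2
      have hle : g.cycleType.sum ≤ n := by
        rw [Equiv.Perm.sum_cycleType]
        simpa using Finset.card_le_univ g.support
      rw [ht] at hle
      simp only [Multiset.sum_replicate, smul_eq_mul] at hle
      refine Finset.mem_biUnion.mpr ⟨g.cycleType.card, ?_, ?_⟩
      · rw [Finset.mem_range]; omega
      · exact Finset.mem_filter.mpr ⟨Finset.mem_univ _, ht⟩
    refine Nat.card_le_card_of_injective (fun η => ⟨_, hmem η⟩) ?_
    intro a b hab
    exact Subtype.ext (Subtype.ext (Subtype.mk.inj hab))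
  calc _ ≤ 2 ^ n * ∑ k ∈ Finset.range (n + 1), (S k).card :=
        Nat.mul_le_mul_left _ (hcard.trans Finset.card_biUnion_le)
    _ = ∑ k ∈ Finset.range (n + 1), 2 ^ n * (S k).card := Finset.mul_sum _ _ _
    _ ≤ ∑ k ∈ Finset.range (n + 1), 4 * n.factorial :=
        Finset.sum_le_sum fun k _ => aux_type_bound n k
    _ = _ := by simp; ring

/-- The probability that a uniformly random element of the alternating group `A_n`
is a non-identity involution (a product of disjoint transpositions and 1-cycles)
tends to `0` as `n → ∞`. -/
theorem involution_probability_alternating :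
    Filter.Tendsto (fun n : ℕ =>
        (Nat.card {η : alternatingGroup (Fin n) // η * η = 1 ∧ η ≠ 1} : ℝ)
          / (Nat.card (alternatingGroup (Fin n)) : ℝ))
      Filter.atTop (nhds 0) := by
  have hlim : Filter.Tendsto (fun n : ℕ => 8 * ((n : ℝ) * (1 / 2) ^ n + (1 / 2) ^ n))
      Filter.atTop (nhds 0) := by
    have h1 := tendsto_self_mul_const_pow_of_lt_one (r := (1 / 2 : ℝ)) (by norm_num) (by norm_num)
    have h2 := tendsto_pow_atTop_nhds_zero_of_lt_one (r := (1 / 2 : ℝ)) (by norm_num) (by norm_num)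
    simpa using (h1.add h2).const_mul 8
  refine tendsto_of_tendsto_of_tendsto_of_le_of_le' tendsto_const_nhds hlim
    (Filter.Eventually.of_forall fun n => by positivity) ?_
  filter_upwards [Filter.eventually_ge_atTop 2] with n hn
  haveI : Nontrivial (Fin n) := Fin.nontrivial_iff_two_le.mpr hn
  have hA : 2 * Nat.card (alternatingGroup (Fin n)) = n.factorial := by
    rw [two_mul_nat_card_alternatingGroup, Nat.card_perm, Nat.card_fin]
  have hB := aux_inv_bound n
  rw [← hA] at hB
  have hpos : (0 : ℝ) < (Nat.card (alternatingGroup (Fin n)) : ℝ) := by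
    exact_mod_cast Nat.card_pos
  rw [div_le_iff₀ hpos]
  have hB' : (2 : ℝ) ^ n * (Nat.card {η : alternatingGroup (Fin n) // η * η = 1 ∧ η ≠ 1} : ℝ)
      ≤ 4 * (n + 1) * (2 * (Nat.card (alternatingGroup (Fin n)) : ℝ)) := by
    exact_mod_cast hB
  have h2 : (0 : ℝ) < 2 ^ n := by positivity
  rw [← mul_le_mul_iff_right₀ h2]
  refine hB'.trans (le_of_eq ?_)
  rw [one_div, inv_pow]
  field_simp
  ring
end

section
/- Let σ, τ be independent uniform random elements of S_n. Then Pr[[σ,τ] is a non-identity involution] → 0 and Pr[[σ,τ] is a non-trivial cyclic permutation] → 0 as n → ∞. (Geometrically: the probability that the random square-tiled surface S(σ,τ) belongs to a principal stratum tends to 0, and the probability that it belongs to a minimal stratum tends to 0, since these events require the commutator to be a product of disjoint transpositions, respectively a non-trivial cycle.) -/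
open Finset
open scoped Classical in
lemma entropyL {G : Type*} [Group G] [Fintype G] (R : G → G → Prop) (M : ℕ)
    (hM : ∀ σ, #{π | R σ π} ≤ M) :
    #{p : G × G | R p.1 (p.1 * p.2 * p.1⁻¹ * p.2⁻¹)} ≤ M * #{p : G × G | Commute p.1 p.2} := by
  simp only [Finset.card_filter, Fintype.sum_prod_type]
  rw [Finset.mul_sum]
  refine Finset.sum_le_sum fun σ _ => ?_
  simp only [← Finset.card_filter]
  have h1 : #{τ | R σ (σ * τ * σ⁻¹ * τ⁻¹)} ≤ #{τ | Commute σ τ} * #{π | R σ π} := by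
    refine Finset.card_le_mul_card_image_of_maps_to (f := fun τ => σ * τ * σ⁻¹ * τ⁻¹) ?_ _ ?_
    · intro τ hτ
      simpa using hτ
    · intro π _
      by_cases hne : ∃ τ0, σ * τ0 * σ⁻¹ * τ0⁻¹ = π
      · obtain ⟨τ0, h0⟩ := hne
        refine Finset.card_le_card_of_injOn (fun τ => τ0⁻¹ * τ) ?_ ?_
        · intro τ hτ
          simp only [Finset.coe_filter, Finset.mem_filter, Finset.mem_univ, true_and, Set.mem_ofPred_eq] at hτ ⊢
          have h2 := hτ.2.trans h0.symm
          have h3 : τ * σ⁻¹ * τ⁻¹ = τ0 * σ⁻¹ * τ0⁻¹ := by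
            simpa [mul_assoc] using h2
          have h4 : (τ * σ⁻¹ * τ⁻¹)⁻¹ = (τ0 * σ⁻¹ * τ0⁻¹)⁻¹ := by rw [h3]
          simp only [mul_inv_rev, inv_inv] at h4
          show σ * (τ0⁻¹ * τ) = τ0⁻¹ * τ * σ
          have h5 : τ * (σ * τ⁻¹) * τ = τ0 * (σ * τ0⁻¹) * τ := by rw [h4]
          have h6 : τ * σ = τ0 * (σ * τ0⁻¹) * τ := by rw [← h5]; group
          rw [mul_assoc τ0⁻¹, h6]; group
        · intro a _ b _ h
          simpa using h
      · rw [Finset.card_eq_zero.2]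
        · exact Nat.zero_le _
        · ext τ
          simp only [Finset.mem_filter, Finset.mem_univ, true_and, Finset.notMem_empty, iff_false, not_and]
          intro _ h
          exact hne ⟨τ, h⟩
  calc _ ≤ _ := h1
    _ ≤ #{τ | Commute σ τ} * M := Nat.mul_le_mul_left _ (hM σ)
    _ = _ := by rw [mul_comm]

open scoped Classical in
lemma commL (n : ℕ) : #{p : Equiv.Perm (Fin n) × Equiv.Perm (Fin n) | Commute p.1 p.2} ≤ 2 ^ n * n.factorial := by
  have h := card_comm_eq_card_conjClasses_mul_card (Equiv.Perm (Fin n))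
  rw [← Fintype.card_subtype, ← Nat.card_eq_fintype_card, h, Nat.card_eq_fintype_card (α := Equiv.Perm (Fin n)), Fintype.card_perm, Fintype.card_fin]
  refine Nat.mul_le_mul_right _ ?_
  have h1 : Nat.card (ConjClasses (Equiv.Perm (Fin n))) ≤ Nat.card (Nat.Partition (Fintype.card (Fin n))) := by
    refine Nat.card_le_card_of_injective (fun c => Quotient.lift (s := IsConj.setoid _) (fun σ => Equiv.Perm.partition σ) (fun a b h => Equiv.Perm.partition_eq_of_isConj.1 h) c) ?_
    rintro ⟨a⟩ ⟨b⟩ h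
    exact Quotient.sound (s := IsConj.setoid _) (Equiv.Perm.partition_eq_of_isConj.2 h)
  have h2 : Nat.card (Nat.Partition n) ≤ Nat.card (Composition n) :=
    Nat.card_le_card_of_surjective _ Nat.Partition.ofComposition_surj
  rw [Fintype.card_fin] at h1
  rw [Nat.card_eq_fintype_card (α := Composition n), composition_card] at h2
  exact h1.trans (h2.trans (Nat.pow_le_pow_right (by norm_num) (Nat.sub_le _ _)))

open scoped Classical in
lemma fixL (n f : ℕ) : #{ρ : Equiv.Perm (Fin n) | f ≤ #{x | ρ x = x}} * f.factorial ≤ n.factorial := by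
  by_cases hf : n < f
  · rw [Finset.card_eq_zero.2]
    · simp
    · ext ρ
      simp only [Finset.mem_filter, Finset.mem_univ, true_and, Finset.notMem_empty, iff_false, not_le]
      refine lt_of_le_of_lt (Finset.card_le_univ _) ?_
      simpa using hf
  push Not at hf
  have h1 : #{ρ : Equiv.Perm (Fin n) | f ≤ #{x | ρ x = x}} ≤ n.choose f * (n - f).factorial := by
    have : ({ρ : Equiv.Perm (Fin n) | f ≤ #{x | ρ x = x}} : Finset _) ⊆
        (Finset.powersetCard f Finset.univ).biUnion fun A => {ρ : Equiv.Perm (Fin n) | ∀ x ∈ A, ρ x = x} := by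
      intro ρ hρ
      simp only [Finset.mem_filter, Finset.mem_univ, true_and] at hρ
      obtain ⟨A, hA, hc⟩ := Finset.exists_subset_card_eq hρ
      simp only [Finset.mem_biUnion, Finset.mem_powersetCard, Finset.mem_filter, Finset.mem_univ, true_and]
      exact ⟨A, ⟨Finset.subset_univ _, hc⟩, fun x hx => by simpa using hA hx⟩
    refine (Finset.card_le_card this).trans ?_
    refine (Finset.card_biUnion_le_card_mul _ _ ((n - f).factorial) ?_).trans ?_
    · intro A hA
      have hA := (Finset.mem_powersetCard.1 hA).2
      have e := Fintype.card_congr (Equiv.Perm.subtypeEquivSubtypePerm (fun x => x ∉ A))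
      simp only [not_not] at e
      rw [← Fintype.card_subtype, ← e, Fintype.card_perm]
      apply le_of_eq
      congr 1
      rw [Fintype.card_subtype_compl]
      simp [hA]
    · simp
  calc _ ≤ n.choose f * (n - f).factorial * f.factorial := Nat.mul_le_mul_right _ h1
    _ = n.choose f * f.factorial * (n - f).factorial := by ring
    _ = _ := Nat.choose_mul_factorial_mul_factorial hf
    _ ≤ _ := le_rfl

open scoped Classical in
lemma rootL (n i : ℕ) (hi : 0 < i) (ρ : Equiv.Perm (Fin n)) :
    #{π : Equiv.Perm (Fin n) | π.IsCycle ∧ π ^ i = ρ} ≤ n ^ i := by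
  have hx : ∀ π : {π : Equiv.Perm (Fin n) // π.IsCycle ∧ π ^ i = ρ}, ∃ x, π.1 x ≠ x :=
    fun π => ⟨π.2.1.choose, π.2.1.choose_spec.1⟩
  choose x0 hx0 using hx
  rw [← Fintype.card_subtype]
  have : Fintype.card (Fin i → Fin n) = n ^ i := by simp
  rw [← this]
  refine Fintype.card_le_of_injective (fun π j => (π.1 ^ (j : ℕ)) (x0 π)) ?_
  intro p q h
  have h0 : x0 p = x0 q := by simpa using congrFun h ⟨0, hi⟩
  have key : ∀ j : ℕ, (p.1 ^ j) (x0 p) = (q.1 ^ j) (x0 p) := by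
    intro j
    have h1 := congrFun h ⟨j % i, Nat.mod_lt _ hi⟩
    simp only at h1
    rw [← h0] at h1
    rw [← Nat.div_add_mod j i, pow_add, pow_add, pow_mul, pow_mul, p.2.2, q.2.2, Equiv.Perm.mul_apply, Equiv.Perm.mul_apply, h1]
  have hq := hx0 q
  rw [← h0] at hq
  apply Subtype.ext
  ext1 y
  by_cases hp : p.1 y = y
  · by_cases hqy : q.1 y = y
    · rw [hp, hqy]
    · obtain ⟨j, hj⟩ := q.2.1.exists_pow_eq hq hqy
      have h2 := key (j + 1)
      rw [pow_succ', pow_succ', Equiv.Perm.mul_apply, Equiv.Perm.mul_apply, key j, hj] at h2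
      exact h2
  · obtain ⟨j, hj⟩ := p.2.1.exists_pow_eq (hx0 p) hp
    have h2 := key (j + 1)
    rw [pow_succ', pow_succ', Equiv.Perm.mul_apply, Equiv.Perm.mul_apply, ← key j, hj] at h2
    exact h2

open scoped Classical in
lemma involL (n : ℕ) : #{π : Equiv.Perm (Fin n) | π * π = 1} ≤ 2 ^ n * n ^ (n / 2) := by
  rcases Nat.eq_zero_or_pos n with rfl | hn
  · refine (Finset.card_le_univ _).trans ?_
    simp
  have hS : ({π : Equiv.Perm (Fin n) | π * π = 1} : Finset _).card ≤
      ∑ A ∈ ((Finset.univ : Finset (Finset (Fin n)))), n ^ (n / 2) := by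
    have hm : ∀ π ∈ ({π : Equiv.Perm (Fin n) | π * π = 1} : Finset _),
       (fun π : Equiv.Perm (Fin n) => ({i | i < π i} : Finset (Fin n))) π ∈ (Finset.univ : Finset (Finset (Fin n))) := by simp
    rw [Finset.card_eq_sum_card_fiberwise hm]
    refine Finset.sum_le_sum fun A _ => ?_
    by_cases hA : A.card ≤ n / 2
    · refine le_trans ?_ (Nat.pow_le_pow_right hn hA)
      have : Fintype.card (A → Fin n) = n ^ A.card := by simp
      rw [← this, ← Finset.card_univ]
      refine Finset.card_le_card_of_injOn (fun π j => π j) (fun _ _ => by simp) ?_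
      intro p hp q hq h
      simp only [Finset.coe_filter, Finset.mem_filter, Finset.mem_univ, true_and, Set.mem_ofPred_eq] at hp hq
      have hpp : ∀ x, p (p x) = x := fun x => by rw [← Equiv.Perm.mul_apply, hp.1]; rfl
      have hqq : ∀ x, q (q x) = x := fun x => by rw [← Equiv.Perm.mul_apply, hq.1]; rfl
      have hpA : ∀ x, x ∈ A ↔ x < p x := fun x => by rw [← hp.2]; simp
      have hqA : ∀ x, x ∈ A ↔ x < q x := fun x => by rw [← hq.2]; simp
      have hpq : ∀ x, x ∈ A → p x = q x := fun x hx => congrFun h ⟨x, hx⟩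
      ext1 x
      rcases lt_trichotomy x (p x) with h1 | h1 | h1
      · exact hpq x ((hpA x).2 h1)
      · rcases lt_trichotomy x (q x) with h2 | h2 | h2
        · exact hpq x ((hqA x).2 h2)
        · rw [← h1, ← h2]
        · have := hpq (q x) ((hqA _).2 (by rwa [hqq]))
          rw [hqq] at this
          apply p.injective; rw [hpp]
          rw [this]
      · have := hpq (p x) ((hpA _).2 (by rwa [hpp]))
        rw [hpp] at this
        apply q.injective; rw [hqq]
        exact this.symm
    · rw [Finset.card_eq_zero.2]
      · exact Nat.zero_le _
      · ext π
        simp only [Finset.mem_filter, Finset.mem_univ, true_and, Finset.notMem_empty, iff_false, not_and]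
        rintro hp rfl
        apply hA
        have hpp : ∀ x, π (π x) = x := fun x => by rw [← Equiv.Perm.mul_apply, hp]; rfl
        have h1 : Disjoint ({i | i < π i} : Finset (Fin n)) (({i | i < π i} : Finset (Fin n)).image π) := by
          rw [Finset.disjoint_left]
          intro a ha hb
          simp only [Finset.mem_filter, Finset.mem_univ, true_and, Finset.mem_image] at ha hb
          obtain ⟨b, hb, rfl⟩ := hb
          rw [hpp] at ha
          exact lt_asymm ha hb
        have h2 := Finset.card_le_univ (({i | i < π i} : Finset (Fin n)) ∪ (({i | i < π i} : Finset (Fin n)).image π))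
        rw [Finset.card_union_of_disjoint h1, Finset.card_image_of_injective _ π.injective, Fintype.card_fin] at h2
        omega
  simpa using hS
open scoped Classical in
noncomputable def lenC {n : ℕ} (π : Equiv.Perm (Fin n)) (b : Fin n) : ℕ := #{y | π.SameCycle b y}

def QC {n : ℕ} (π : Equiv.Perm (Fin n)) : Prop :=
  ∃ D : Finset (Fin n), D.card ≤ 4 ∧ ∀ z, π z ≠ z → ∃ d ∈ D, π.SameCycle z d

lemma lenC_congr {n : ℕ} {π : Equiv.Perm (Fin n)} {b d : Fin n} (h : π.SameCycle b d) :
    lenC π b = lenC π d := by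
  unfold lenC
  congr 1
  ext y
  simp only [Finset.mem_filter, Finset.mem_univ, true_and]
  exact ⟨fun h1 => h.symm.trans h1, fun h1 => h.trans h1⟩

lemma lenC_pos {n : ℕ} (π : Equiv.Perm (Fin n)) (b : Fin n) : 0 < lenC π b := by
  unfold lenC
  refine Finset.card_pos.2 ⟨b, ?_⟩
  simp only [Finset.mem_filter, Finset.mem_univ, true_and]
  exact Equiv.Perm.SameCycle.refl _ _

open scoped Classical in
lemma weightL {n : ℕ} (π : Equiv.Perm (Fin n)) (h : QC π) :
    ∑ b, (if π b ≠ b then (1 : ℝ) / lenC π b else 0) ≤ 4 := by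
  obtain ⟨D, hD, h⟩ := h
  have h1 : ∀ b, (if π b ≠ b then (1 : ℝ) / lenC π b else 0) ≤
      ∑ d ∈ D, (if π.SameCycle d b then (1 : ℝ) / lenC π d else 0) := by
    intro b
    have hnn : ∀ d ∈ D, (0 : ℝ) ≤ (if π.SameCycle d b then (1 : ℝ) / lenC π d else 0) := by
      intro d _; split_ifs <;> positivity
    split_ifs with hb
    · obtain ⟨d, hd, hs⟩ := h b hb
      refine le_trans ?_ (Finset.single_le_sum hnn hd)
      rw [if_pos hs.symm, lenC_congr hs]
    · exact Finset.sum_nonneg hnn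
  refine (Finset.sum_le_sum fun b _ => h1 b).trans ?_
  rw [Finset.sum_comm]
  have h2 : ∀ d ∈ D, ∑ b, (if π.SameCycle d b then (1 : ℝ) / lenC π d else 0) = 1 := by
    intro d _
    rw [← Finset.sum_filter, Finset.sum_const, nsmul_eq_mul]
    have : (0 : ℝ) < lenC π d := by exact_mod_cast lenC_pos π d
    show (lenC π d : ℝ) * _ = 1
    field_simp
  rw [Finset.sum_congr rfl h2]
  simp only [Finset.sum_const, nsmul_eq_mul, mul_one]
  exact_mod_cast hD

lemma pow_ne_self {n : ℕ} {π : Equiv.Perm (Fin n)} (hc : π.IsCycle) {x : Fin n} (hx : π x ≠ x)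
    {i : ℕ} (h0 : 0 < i) (hi : i < π.support.card) : (π ^ i) x ≠ x := by
  intro h
  have h1 : π ^ i = 1 := hc.pow_eq_one_iff.2 ⟨x, hx, h⟩
  have := orderOf_dvd_of_pow_eq_one h1
  rw [hc.orderOf] at this
  exact absurd (Nat.le_of_dvd h0 this) (by omega)

lemma pow_inj_lt {n : ℕ} {π : Equiv.Perm (Fin n)} (hc : π.IsCycle) {x : Fin n} (hx : π x ≠ x)
    {i j : ℕ} (h0 : i < j) (hi : j - i < π.support.card) : (π ^ i) x ≠ (π ^ j) x := by
  intro h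
  have e : j = i + (j - i) := by omega
  rw [e, pow_add, Equiv.Perm.mul_apply] at h
  exact pow_ne_self hc hx (by omega) hi ((π ^ i).injective h).symm

lemma switchL {n : ℕ} (σ τ π π' : Equiv.Perm (Fin n)) (hπ : π = σ * τ * σ⁻¹ * τ⁻¹)
    (hc : π.IsCycle) (x : Fin n) (hx : π x ≠ x) (k : ℕ) (hk : 2 ≤ k) (hk2 : k < π.support.card)
    (hg : ∀ i, 1 ≤ i → i ≤ k → σ x ≠ (π ^ i) x ∧ σ ((π ^ k) x) ≠ (π ^ i) x)
    (hπ' : π' = σ * (Equiv.swap x ((π ^ k) x) * τ) * σ⁻¹ * (Equiv.swap x ((π ^ k) x) * τ)⁻¹) :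
    lenC π' ((π ^ k) x) = k ∧ π' ((π ^ k) x) ≠ (π ^ k) x ∧ QC π' := by
  set b := (π ^ k) x with hb
  have hform : ∀ y, π' y = Equiv.swap (σ x) (σ b) (π (Equiv.swap x b y)) := by
    intro y
    have : π' = Equiv.swap (σ x) (σ b) * π * Equiv.swap x b := by
      rw [hπ', hπ, mul_inv_rev, Equiv.swap_inv]
      have : Equiv.swap (σ x) (σ b) = σ * Equiv.swap x b * σ⁻¹ := by
        rw [Equiv.mul_swap_eq_swap_mul]; simp
      rw [this]; group
    rw [this]; rfl
  have hnx : ∀ i, 1 ≤ i → i ≤ k → (π ^ i) x ≠ x := fun i h1 h2 => pow_ne_self hc hx (by omega) (by omega)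
  have hnb : ∀ i, 1 ≤ i → i < k → (π ^ i) x ≠ b := fun i h1 h2 => pow_inj_lt hc hx h2 (by omega)
  have hswap : ∀ i, 1 ≤ i → i ≤ k → Equiv.swap (σ x) (σ b) ((π ^ i) x) = (π ^ i) x := fun i h1 h2 =>
    Equiv.swap_apply_of_ne_of_ne (hg i h1 h2).1.symm (hg i h1 h2).2.symm
  have hstep : ∀ i, 1 ≤ i → i < k → π' ((π ^ i) x) = (π ^ (i + 1)) x := by
    intro i h1 h2
    rw [hform, Equiv.swap_apply_of_ne_of_ne (hnx i h1 h2.le) (hnb i h1 h2)]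
    have := hswap (i + 1) (by omega) (by omega)
    rw [pow_succ', Equiv.Perm.mul_apply] at this ⊢
    exact this
  have hlast : π' b = (π ^ 1) x := by
    rw [hform, Equiv.swap_apply_right]
    simpa using hswap 1 le_rfl (by omega)
  have hpow : ∀ j, 1 ≤ j → j ≤ k → (π' ^ j) b = (π ^ j) x := by
    intro j h1
    induction j, h1 using Nat.le_induction with
    | base => intro _; simpa using hlast
    | succ j h1 ih =>
      intro h2
      rw [pow_succ', Equiv.Perm.mul_apply, ih (by omega), hstep j h1 (by omega)]
  have hclosed : ∀ j, ∃ i, 1 ≤ i ∧ i ≤ k ∧ (π' ^ j) b = (π ^ i) x := by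
    intro j
    induction j with
    | zero => exact ⟨k, by omega, le_rfl, rfl⟩
    | succ j ih =>
      obtain ⟨i, h1, h2, h3⟩ := ih
      rw [pow_succ', Equiv.Perm.mul_apply, h3]
      rcases h2.lt_or_eq with h | h
      · exact ⟨i + 1, by omega, by omega, hstep i h1 h⟩
      · subst h
        exact ⟨1, le_rfl, by omega, hlast⟩
  refine ⟨?_, ?_, ?_⟩
  · classical
    have : ({y | π'.SameCycle b y} : Finset (Fin n)) = (Finset.Icc 1 k).image (fun i => (π ^ i) x) := by
      ext y
      simp only [Finset.mem_filter, Finset.mem_univ, true_and, Finset.mem_image, Finset.mem_Icc]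
      constructor
      · intro h
        obtain ⟨j, rfl⟩ := h.exists_nat_pow_eq
        obtain ⟨i, h1, h2, h3⟩ := hclosed j
        exact ⟨i, ⟨h1, h2⟩, h3.symm⟩
      · rintro ⟨i, ⟨h1, h2⟩, rfl⟩
        rw [← hpow i h1 h2]
        exact ⟨i, by simp⟩
    have h2 : lenC π' b = #((Finset.Icc 1 k).image (fun i => (π ^ i) x)) := by
      rw [← this]; unfold lenC; congr
    rw [h2, Finset.card_image_of_injOn]
    · simp
    · intro i hi j hj h
      simp only [Finset.coe_Icc, Set.mem_Icc] at hi hj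
      by_contra hne
      rcases lt_or_gt_of_ne hne with h3 | h3
      · exact pow_inj_lt hc hx h3 (by omega) h
      · exact pow_inj_lt hc hx h3 (by omega) h.symm
  · rw [hlast]
    exact hnb 1 le_rfl (by omega)
  · refine ⟨{x, b, π⁻¹ (σ x), π⁻¹ (σ b)}, Finset.card_le_four, ?_⟩
    intro z hz
    by_contra hno
    push Not at hno
    simp only [Finset.mem_insert, Finset.mem_singleton, forall_eq_or_imp, forall_eq] at hno
    obtain ⟨n1, n2, n3, n4⟩ := hno
    have agree : ∀ y, π'.SameCycle z y → π' y = π y := by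
      intro y hy
      have e1 : y ≠ x := by rintro rfl; exact n1 hy
      have e2 : y ≠ b := by rintro rfl; exact n2 hy
      have e3 : π y ≠ σ x := by
        intro h; apply n3; rw [← h]; simpa using hy
      have e4 : π y ≠ σ b := by
        intro h; apply n4; rw [← h]; simpa using hy
      rw [hform, Equiv.swap_apply_of_ne_of_ne e1 e2, Equiv.swap_apply_of_ne_of_ne e3 e4]
    have agp : ∀ j : ℕ, (π' ^ j) z = (π ^ j) z := by
      intro j
      induction j with
      | zero => rfl
      | succ j ih =>
        rw [pow_succ', pow_succ', Equiv.Perm.mul_apply, Equiv.Perm.mul_apply, ← ih]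
        exact agree _ ⟨j, by simp⟩
    have hz2 : π z ≠ z := by
      rw [← agree z (Equiv.Perm.SameCycle.refl _ _)]; exact hz
    obtain ⟨j, hj⟩ := hc.exists_pow_eq hz2 hx
    apply n1
    rw [← hj, ← agp j]
    exact ⟨j, by simp⟩

open scoped Classical in
lemma goodL {n : ℕ} (σ π : Equiv.Perm (Fin n)) (K f : ℕ) (h1 : #{x | π x = x} ≤ f)
    (h2 : ∀ i : ℤ, -K ≤ i → i ≤ K → #{y | σ y = (π ^ i) y} ≤ f) (k : ℕ) (hk : k ≤ K) :
    n ≤ #{x | π x ≠ x ∧ ∀ i, 1 ≤ i → i ≤ k → σ x ≠ (π ^ i) x ∧ σ ((π ^ k) x) ≠ (π ^ i) x} + f + 2 * K * f := by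
  set S : Finset (Fin n) := {x | π x ≠ x ∧ ∀ i, 1 ≤ i → i ≤ k → σ x ≠ (π ^ i) x ∧ σ ((π ^ k) x) ≠ (π ^ i) x}
  have hcov : (Finset.univ : Finset (Fin n)) ⊆ S ∪ ({x | π x = x} : Finset (Fin n)) ∪
      (Finset.Icc 1 k).biUnion (fun i => ({x | σ x = (π ^ i) x} : Finset (Fin n)) ∪
        ({x | σ ((π ^ k) x) = (π ^ i) x} : Finset (Fin n))) := by
    intro x _
    simp only [Finset.mem_union, Finset.mem_biUnion, Finset.mem_filter, Finset.mem_univ, true_and, Finset.mem_Icc, S]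
    by_contra hno
    push Not at hno
    obtain ⟨⟨a1, a2⟩, a3⟩ := hno
    obtain ⟨i, b1, b2, b3⟩ := a1 a2
    have := a3 i ⟨b1, b2⟩
    exact this.2 (b3 this.1)
  have hb : #((Finset.Icc 1 k).biUnion (fun i => ({x | σ x = (π ^ i) x} : Finset (Fin n)) ∪
        ({x | σ ((π ^ k) x) = (π ^ i) x} : Finset (Fin n)))) ≤ k * (f + f) := by
    refine (Finset.card_biUnion_le_card_mul _ _ (f + f) ?_).trans (by simp)
    intro i hi
    rw [Finset.mem_Icc] at hi
    refine (Finset.card_union_le _ _).trans (add_le_add ?_ ?_)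
    · have := h2 i (by omega) (by omega)
      simpa using this
    · refine le_trans ?_ (h2 ((i : ℤ) - k) (by omega) (by omega))
      refine Finset.card_le_card_of_injOn (fun x => (π ^ k) x) ?_ ((π ^ k).injective.injOn)
      intro x hx
      simp only [Finset.coe_filter, Finset.mem_univ, true_and, Set.mem_ofPred_eq] at hx ⊢
      rw [hx, ← zpow_natCast π k, ← Equiv.Perm.mul_apply, ← zpow_add, sub_add_cancel, zpow_natCast]
  have := (Finset.card_le_card hcov).trans ((Finset.card_union_le _ _).trans (add_le_add (Finset.card_union_le _ _) hb))
  rw [Finset.card_univ, Fintype.card_fin] at this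
  have h3 : k * (f + f) ≤ 2 * K * f := by nlinarith
  omega

def GC {n : ℕ} (K f : ℕ) (σ π : Equiv.Perm (Fin n)) : Prop :=
  π.IsCycle ∧ (Finset.univ.filter fun x => π x = x).card ≤ f ∧
    ∀ i : ℤ, -K ≤ i → i ≤ K → (Finset.univ.filter fun y => σ y = (π ^ i) y).card ≤ f

def cmt {n : ℕ} (p : Equiv.Perm (Fin n) × Equiv.Perm (Fin n)) : Equiv.Perm (Fin n) :=
  p.1 * p.2 * p.1⁻¹ * p.2⁻¹

open scoped Classical in
lemma mainL (n K f : ℕ) (hK : 1 ≤ K) (hf : 8 * K * f ≤ n) (hn : 2 * K < n) :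
    (#{p : Equiv.Perm (Fin n) × Equiv.Perm (Fin n) | GC K f p.1 (cmt p)} : ℝ) *
      ∑ k ∈ Finset.Icc 2 K, (1 : ℝ) / k ≤ 16 * (n.factorial : ℝ) ^ 2 := by
  set P := Equiv.Perm (Fin n) × Equiv.Perm (Fin n)
  set G : Finset P := {p : P | GC K f p.1 (cmt p)}
  let good : ℕ → P → Finset (Fin n) := fun k p =>
    {x | cmt p x ≠ x ∧ ∀ i, 1 ≤ i → i ≤ k → p.1 x ≠ (cmt p ^ i) x ∧ p.1 ((cmt p ^ k) x) ≠ (cmt p ^ i) x}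
  let I : Finset (ℕ × P × Fin n) := ((Finset.Icc 2 K) ×ˢ (G ×ˢ Finset.univ)).filter
    (fun t => t.2.2 ∈ good t.1 t.2.1)
  let w : P × Fin n × Fin n → ℝ := fun q =>
    if QC (cmt q.1) then (if cmt q.1 q.2.2 ≠ q.2.2 then (1 : ℝ) / lenC (cmt q.1) q.2.2 else 0) else 0
  let Φ : ℕ × P × Fin n → P × Fin n × Fin n := fun t =>
    ((t.2.1.1, Equiv.swap t.2.2 ((cmt t.2.1 ^ t.1) t.2.2) * t.2.1.2), t.2.2, (cmt t.2.1 ^ t.1) t.2.2)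
  have hf8 : 8 * f ≤ n := le_trans (by nlinarith) hf
  have hI : ∀ t ∈ I, lenC (cmt (Φ t).1) (Φ t).2.2 = t.1 ∧ cmt (Φ t).1 (Φ t).2.2 ≠ (Φ t).2.2 ∧
      QC (cmt (Φ t).1) := by
    rintro ⟨k, ⟨σ, τ⟩, x⟩ ht
    simp only [I, G, good, Finset.mem_filter, Finset.mem_product, Finset.mem_Icc, Finset.mem_univ, true_and, and_true] at ht
    obtain ⟨⟨⟨k1, k2⟩, hG⟩, hx, hg⟩ := ht
    refine switchL σ τ (cmt (σ, τ)) _ rfl hG.1 x hx k k1 ?_ hg rfl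
    have h1 := hG.2.1
    have h2 : #(cmt (σ, τ)).support + #{x | cmt (σ, τ) x = x} = n := by
      have := Finset.card_filter_add_card_filter_not (s := (Finset.univ : Finset (Fin n))) (fun x => cmt (σ, τ) x ≠ x)
      simp only [not_not, Finset.card_univ, Fintype.card_fin] at this
      refine Eq.trans ?_ this
      congr 1
    have h1' : #{x | cmt (σ, τ) x = x} ≤ f := by convert h1
    omega
  have hinj : Set.InjOn Φ I := by
    intro t ht s hs h
    have e1 := (hI t ht).1
    have e2 := (hI s hs).1
    rw [h, e2] at e1
    obtain ⟨k, ⟨σ, τ⟩, x⟩ := t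
    obtain ⟨k', ⟨σ', τ'⟩, x'⟩ := s
    have h1 : σ = σ' := congrArg (fun q => q.1.1) h
    have h2 : Equiv.swap x ((cmt (σ, τ) ^ k) x) * τ = Equiv.swap x' ((cmt (σ', τ') ^ k') x') * τ' :=
      congrArg (fun q => q.1.2) h
    have h3 : x = x' := congrArg (fun q => q.2.1) h
    have h4 : (cmt (σ, τ) ^ k) x = (cmt (σ', τ') ^ k') x' := congrArg (fun q => q.2.2) h
    rw [h4, h3] at h2
    have h5 : τ = τ' := mul_left_cancel h2
    have h6 : k' = k := e1
    rw [h1, h3, h5, h6]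
  have hw0 : ∀ q, 0 ≤ w q := by
    intro q
    simp only [w]
    split_ifs <;> positivity
  have hup : ∑ t ∈ I, (1 : ℝ) / t.1 ≤ (n.factorial : ℝ) ^ 2 * (n * 4) := by
    calc ∑ t ∈ I, (1 : ℝ) / t.1 = ∑ t ∈ I, w (Φ t) := by
          refine Finset.sum_congr rfl fun t ht => ?_
          obtain ⟨a1, a2, a3⟩ := hI t ht
          simp only [w]
          rw [if_pos a3, if_pos a2, a1]
      _ = ∑ q ∈ I.image Φ, w q := (Finset.sum_image hinj).symm
      _ ≤ ∑ q, w q := Finset.sum_le_sum_of_subset_of_nonneg (Finset.subset_univ _) (fun q _ _ => hw0 q)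
      _ = ∑ p : P, ∑ a : Fin n, ∑ b : Fin n, w (p, a, b) := by
          rw [Fintype.sum_prod_type]
          refine Finset.sum_congr rfl fun p _ => ?_
          rw [Fintype.sum_prod_type]
      _ ≤ ∑ p : P, ∑ a : Fin n, (4 : ℝ) := by
          refine Finset.sum_le_sum fun p _ => Finset.sum_le_sum fun a _ => ?_
          simp only [w]
          by_cases hQ : QC (cmt p)
          · simp only [if_pos hQ]
            exact weightL _ hQ
          · simp [hQ]
      _ = _ := by
          simp [P, Fintype.card_perm, sq]
  have hlow : (#G : ℝ) * (∑ k ∈ Finset.Icc 2 K, (1 : ℝ) / k) * (n / 4) ≤ ∑ t ∈ I, (1 : ℝ) / t.1 := by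
    have e : ∑ t ∈ I, (1 : ℝ) / t.1 = ∑ k ∈ Finset.Icc 2 K, ∑ p ∈ G, ∑ x ∈ good k p, (1 : ℝ) / k := by
      simp only [I]
      rw [Finset.sum_filter, Finset.sum_product]
      refine Finset.sum_congr rfl fun k _ => ?_
      rw [Finset.sum_product]
      refine Finset.sum_congr rfl fun p _ => ?_
      simp only
      rw [← Finset.sum_filter]
      congr 1
      ext x; simp
    rw [e, Finset.mul_sum, Finset.sum_mul]
    refine Finset.sum_le_sum fun k hk => ?_
    rw [Finset.mem_Icc] at hk
    have : ∑ p ∈ G, (1 : ℝ) / k * (n / 4) ≤ ∑ p ∈ G, ∑ x ∈ good k p, (1 : ℝ) / k := by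
      refine Finset.sum_le_sum fun p hp => ?_
      rw [Finset.sum_const, nsmul_eq_mul, mul_comm]
      refine mul_le_mul_of_nonneg_right ?_ (by positivity)
      have hG : GC K f p.1 (cmt p) := by simpa [G] using hp
      have h3 := goodL p.1 (cmt p) K f (by convert hG.2.1) (fun i a b => by convert hG.2.2 i a b) k hk.2
      have h4 : n ≤ 4 * #(good k p) := by
        have : n ≤ #(good k p) + f + 2 * K * f := h3
        nlinarith
      have h5 : (n : ℝ) ≤ 4 * #(good k p) := by exact_mod_cast h4
      linarith
    refine le_trans (le_of_eq ?_) this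
    rw [Finset.sum_const, nsmul_eq_mul]; ring
  have hn0 : (0 : ℝ) < n := by
    have : 0 < n := by omega
    exact_mod_cast this
  have := hlow.trans hup
  refine le_of_mul_le_mul_right ?_ (show (0 : ℝ) < n / 4 by positivity)
  linarith

open scoped Classical in
lemma fiberL (n K f : ℕ) (hn : 0 < n) (i : ℤ) (h0 : i ≠ 0) (h1 : -K ≤ i) (h2 : i ≤ K) (σ : Equiv.Perm (Fin n)) :
    #{π : Equiv.Perm (Fin n) | π.IsCycle ∧ f ≤ #{y | σ y = (π ^ i) y}} ≤
      n ^ K * #{ρ : Equiv.Perm (Fin n) | f ≤ #{x | ρ x = x}} := by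
  refine Finset.card_le_mul_card_image_of_maps_to (f := fun π => σ⁻¹ * π ^ i) ?_ _ ?_
  · intro π hπ
    simp only [Finset.mem_filter, Finset.mem_univ, true_and] at hπ ⊢
    refine hπ.2.trans (le_of_eq ?_)
    congr 1
    ext y
    rw [Finset.mem_filter, Finset.mem_filter, Equiv.Perm.mul_apply, Equiv.Perm.inv_eq_iff_eq]
    simp only [Finset.mem_univ, true_and]
    exact eq_comm
  · intro ρ _
    have hp : n ^ i.natAbs ≤ n ^ K := Nat.pow_le_pow_right hn (by omega)
    refine le_trans ?_ hp
    rcases Int.natAbs_eq i with hi | hi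
    · refine le_trans (Finset.card_le_card ?_) (rootL n i.natAbs (by omega) (σ * ρ))
      intro π hπ
      simp only [Finset.mem_filter, Finset.mem_univ, true_and] at hπ ⊢
      refine ⟨hπ.1.1, ?_⟩
      rw [← hπ.2, mul_inv_cancel_left, ← zpow_natCast, ← hi]
    · refine le_trans (Finset.card_le_card ?_) (rootL n i.natAbs (by omega) (σ * ρ)⁻¹)
      intro π hπ
      simp only [Finset.mem_filter, Finset.mem_univ, true_and] at hπ ⊢
      refine ⟨hπ.1.1, ?_⟩
      rw [← hπ.2, mul_inv_cancel_left, ← zpow_natCast, ← zpow_neg]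
      congr 1; omega

open scoped Classical in
lemma badL (n K f : ℕ) (hn : 0 < n) :
    #{p : Equiv.Perm (Fin n) × Equiv.Perm (Fin n) | (cmt p).IsCycle ∧ ¬ GC K f p.1 (cmt p)} * f.factorial
      ≤ (2 * K + 2) * (n ^ K * 2 ^ n) * n.factorial ^ 2 := by
  set F := #{ρ : Equiv.Perm (Fin n) | f ≤ #{x | ρ x = x}} with hF
  have hFf : F * f.factorial ≤ n.factorial := fixL n f
  have hone : 1 ≤ n ^ K := Nat.one_le_pow _ _ hn
  have htwo : 1 ≤ 2 ^ n := Nat.one_le_two_pow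
  have hcom := commL n
  let B0 : Finset (Equiv.Perm (Fin n) × Equiv.Perm (Fin n)) := {p | f ≤ #{x | cmt p x = x}}
  let B : ℤ → Finset (Equiv.Perm (Fin n) × Equiv.Perm (Fin n)) := fun i =>
    {p | (cmt p).IsCycle ∧ f ≤ #{y | p.1 y = (cmt p ^ i) y}}
  have hB0 : #B0 ≤ (F * n ^ K) * (2 ^ n * n.factorial) := by
    have := entropyL (G := Equiv.Perm (Fin n)) (fun _ π => f ≤ #{x | π x = x}) F (fun σ => le_of_eq (by rw [hF]; congr!))
    refine le_trans (le_of_eq ?_) (this.trans (Nat.mul_le_mul (Nat.le_mul_of_pos_right _ hone) hcom))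
    simp only [B0]; congr!
  have hB : ∀ i ∈ Finset.Icc (-(K : ℤ)) K, #(B i) ≤ (F * n ^ K) * (2 ^ n * n.factorial) := by
    intro i hi
    rw [Finset.mem_Icc] at hi
    by_cases h0 : i = 0
    · subst h0
      have h1 : B 0 ⊆ ({ρ : Equiv.Perm (Fin n) | f ≤ #{x | ρ x = x}} : Finset _) ×ˢ Finset.univ := by
        intro p hp
        simp only [B, zpow_zero, Equiv.Perm.coe_one, id, Finset.mem_filter, Finset.mem_univ, true_and] at hp
        simp only [Finset.mem_product, Finset.mem_filter, Finset.mem_univ, true_and, and_true]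
        exact hp.2
      have h2 := Finset.card_le_card h1
      rw [Finset.card_product, Finset.card_univ, Fintype.card_perm, Fintype.card_fin] at h2
      refine h2.trans (Nat.mul_le_mul (Nat.le_mul_of_pos_right _ hone) (Nat.le_mul_of_pos_left _ htwo))
    · have := entropyL (G := Equiv.Perm (Fin n)) (fun σ π => π.IsCycle ∧ f ≤ #{y | σ y = (π ^ i) y}) (F * n ^ K)
        (fun σ => by rw [mul_comm]; convert fiberL n K f hn i h0 hi.1 hi.2 σ)
      refine le_trans (le_of_eq ?_) (this.trans (Nat.mul_le_mul_left _ hcom))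
      simp only [B]; congr!
  have hcov : ({p : Equiv.Perm (Fin n) × Equiv.Perm (Fin n) | (cmt p).IsCycle ∧ ¬ GC K f p.1 (cmt p)} : Finset _) ⊆
      B0 ∪ (Finset.Icc (-(K : ℤ)) K).biUnion B := by
    intro p hp
    simp only [Finset.mem_filter, Finset.mem_univ, true_and] at hp
    simp only [B0, B, Finset.mem_union, Finset.mem_biUnion, Finset.mem_filter, Finset.mem_univ, true_and, Finset.mem_Icc]
    by_contra hno
    push Not at hno
    refine hp.2 ⟨hp.1, ?_, fun i a b => ?_⟩
    · have := hno.1.le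
      convert this
    · have := (hno.2 i ⟨a, b⟩ hp.1).le
      convert this
  have h3 := (Finset.card_le_card hcov).trans ((Finset.card_union_le _ _).trans
    (add_le_add hB0 (Finset.card_biUnion_le_card_mul _ _ _ hB)))
  have h4 : #(Finset.Icc (-(K : ℤ)) K) = 2 * K + 1 := by
    rw [Int.card_Icc]; omega
  rw [h4] at h3
  calc _ ≤ _ := Nat.mul_le_mul_right _ h3
    _ = (2 * K + 2) * (n ^ K * 2 ^ n) * n.factorial * (F * f.factorial) := by ring
    _ ≤ (2 * K + 2) * (n ^ K * 2 ^ n) * n.factorial * n.factorial := Nat.mul_le_mul_left _ hFf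
    _ = _ := by ring

open Filter Topology

lemma limL (K : ℕ) (hK : 1 ≤ K) : Tendsto (fun n : ℕ => ((2 * K + 2 : ℝ) * ((n : ℝ) ^ K * 2 ^ n)) / ((n / (8 * K)).factorial : ℝ)) atTop (𝓝 0) := by
  set c : ℝ := 2 ^ ((K + 1) * (8 * K)) with hc
  have h1 : Tendsto (fun n : ℕ => (2 * K + 2 : ℝ) * c * (c ^ (n / (8 * K)) / ((n / (8 * K)).factorial : ℝ))) atTop (𝓝 0) := by
    have := (FloorSemiring.tendsto_pow_div_factorial_atTop c).comp (Nat.tendsto_div_const_atTop (n := 8 * K) (by omega))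
    simpa using this.const_mul ((2 * K + 2 : ℝ) * c)
  refine squeeze_zero (fun n => by positivity) (fun n => ?_) h1
  rw [← mul_div_assoc]
  refine div_le_div_of_nonneg_right ?_ (by positivity)
  rw [mul_assoc]
  refine mul_le_mul_of_nonneg_left ?_ (by positivity)
  have h2 : (n : ℝ) ^ K * 2 ^ n ≤ 2 ^ (n * (K + 1)) := by
    have : (n : ℝ) ≤ 2 ^ n := by exact_mod_cast (Nat.lt_two_pow_self (n := n)).le
    calc (n : ℝ) ^ K * 2 ^ n ≤ (2 ^ n) ^ K * 2 ^ n := by gcongr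
      _ = _ := by rw [← pow_succ, ← pow_mul]
  refine h2.trans ?_
  rw [← pow_succ', hc, ← pow_mul]
  refine pow_le_pow_right₀ (by norm_num) ?_
  have : n ≤ 8 * K * (n / (8 * K) + 1) := (Nat.lt_mul_div_succ n (by omega)).le
  calc n * (K + 1) ≤ (8 * K * (n / (8 * K) + 1)) * (K + 1) := Nat.mul_le_mul_right _ this
    _ = _ := by ring

lemma harmL : Tendsto (fun K : ℕ => ∑ k ∈ Finset.Icc 2 K, (1 : ℝ) / k) atTop atTop := by
  have h := Real.tendsto_sum_range_one_div_nat_succ_atTop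
  have h2 := tendsto_atTop_add_const_right atTop (-1 : ℝ) h
  refine tendsto_atTop_mono' _ ?_ h2
  filter_upwards [eventually_ge_atTop 1] with K hK
  have : ∑ i ∈ Finset.range K, (1 : ℝ) / (i + 1) = ∑ k ∈ Finset.Icc 1 K, (1 : ℝ) / k := by
    have h3 := Finset.sum_Ico_add' (fun k : ℕ => (1 : ℝ) / k) 0 K 1
    rw [Finset.range_eq_Ico]
    refine Eq.trans ?_ (h3.trans ?_)
    · simp
    · rfl
  rw [this, ← Finset.add_sum_Ioc_eq_sum_Icc hK]
  have e : Finset.Ioc 1 K = Finset.Icc 2 K := by ext; simp [Nat.succ_le_iff]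
  rw [e]; simp

open scoped Classical in
lemma cycleT : Tendsto (fun n : ℕ => (#{p : Equiv.Perm (Fin n) × Equiv.Perm (Fin n) | (cmt p).IsCycle} : ℝ) / (n.factorial : ℝ) ^ 2)
    atTop (𝓝 0) := by
  rw [Metric.tendsto_atTop']
  intro ε hε
  obtain ⟨K, hK1, hK⟩ := ((eventually_ge_atTop 1).and (harmL.eventually_gt_atTop (32 / ε))).exists
  have hl := (limL K hK1).eventually (gt_mem_nhds (show (0 : ℝ) < ε / 2 by positivity))
  obtain ⟨N, hN⟩ := eventually_atTop.1 (hl.and (eventually_gt_atTop (2 * K)))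
  refine ⟨N, fun n hn => ?_⟩
  obtain ⟨hn1, hn2⟩ := hN n hn.le
  set f := n / (8 * K)
  have hm := mainL n K f hK1 (Nat.mul_div_le n (8 * K)) hn2
  have hb := badL n K f (by omega)
  set H := ∑ k ∈ Finset.Icc 2 K, (1 : ℝ) / k
  have hH : 0 < H := lt_trans (by positivity) hK
  set X := #{p : Equiv.Perm (Fin n) × Equiv.Perm (Fin n) | (cmt p).IsCycle}
  set Y := #{p : Equiv.Perm (Fin n) × Equiv.Perm (Fin n) | GC K f p.1 (cmt p)}
  set Z := #{p : Equiv.Perm (Fin n) × Equiv.Perm (Fin n) | (cmt p).IsCycle ∧ ¬ GC K f p.1 (cmt p)}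
  have hXYZ : X ≤ Y + Z := by
    refine le_trans (Finset.card_le_card ?_) (Finset.card_union_le _ _)
    intro p hp
    simp only [Finset.mem_union, Finset.mem_filter, Finset.mem_univ, true_and] at hp ⊢
    tauto
  have hfac : (0 : ℝ) < (n.factorial : ℝ) ^ 2 := by positivity
  have hY : (Y : ℝ) ≤ ε / 2 * (n.factorial : ℝ) ^ 2 := by
    have h1 : (Y : ℝ) * (32 / ε) ≤ 16 * (n.factorial : ℝ) ^ 2 :=
      (mul_le_mul_of_nonneg_left hK.le (by positivity)).trans hm
    have h2 : (Y : ℝ) = (Y : ℝ) * (32 / ε) * (ε / 32) := by field_simp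
    rw [h2]
    have := mul_le_mul_of_nonneg_right h1 (show 0 ≤ ε / 32 by positivity)
    linarith
  have hZ : (Z : ℝ) < ε / 2 * (n.factorial : ℝ) ^ 2 := by
    have h1 : (Z : ℝ) * f.factorial ≤ (2 * K + 2) * ((n : ℝ) ^ K * 2 ^ n) * (n.factorial : ℝ) ^ 2 := by exact_mod_cast hb
    have hf0 : (0 : ℝ) < f.factorial := by positivity
    have h2 : (Z : ℝ) ≤ ((2 * K + 2 : ℝ) * ((n : ℝ) ^ K * 2 ^ n)) / (f.factorial : ℝ) * (n.factorial : ℝ) ^ 2 := by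
      rw [div_mul_eq_mul_div, le_div_iff₀ hf0]
      exact h1
    exact h2.trans_lt (mul_lt_mul_of_pos_right hn1 hfac)
  have hX : (X : ℝ) ≤ Y + Z := by exact_mod_cast hXYZ
  rw [Real.dist_eq, sub_zero, abs_of_nonneg (by positivity), div_lt_iff₀ hfac]
  linarith

open scoped Classical in
lemma involT : Tendsto (fun n : ℕ => (#{p : Equiv.Perm (Fin n) × Equiv.Perm (Fin n) | cmt p * cmt p = 1} : ℝ) / (n.factorial : ℝ) ^ 2)
    atTop (𝓝 0) := by
  have hlim : Tendsto (fun n : ℕ => Real.sqrt ((16 * Real.exp 1) ^ n / (n.factorial : ℝ))) atTop (𝓝 0) := by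
    have := (FloorSemiring.tendsto_pow_div_factorial_atTop (16 * Real.exp 1)).sqrt
    simpa using this
  refine squeeze_zero' (Eventually.of_forall fun n => by positivity) ?_ hlim
  filter_upwards [eventually_ge_atTop 1] with n hn
  apply Real.le_sqrt_of_sq_le
  have h1 := entropyL (G := Equiv.Perm (Fin n)) (fun _ π => π * π = 1) (2 ^ n * n ^ (n / 2)) (fun σ => by convert involL n)
  have h2 : #{p : Equiv.Perm (Fin n) × Equiv.Perm (Fin n) | cmt p * cmt p = 1} ≤ 2 ^ n * n ^ (n / 2) * (2 ^ n * n.factorial) :=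
    by
    refine le_trans (le_of_eq ?_) (h1.trans (Nat.mul_le_mul_left _ (commL n)))
    congr!
  set X := #{p : Equiv.Perm (Fin n) × Equiv.Perm (Fin n) | cmt p * cmt p = 1}
  have h3 : X ^ 2 ≤ 16 ^ n * n ^ n * n.factorial ^ 2 := by
    calc X ^ 2 ≤ (2 ^ n * n ^ (n / 2) * (2 ^ n * n.factorial)) ^ 2 := Nat.pow_le_pow_left h2 2
      _ = (2 ^ n * 2 ^ n * (2 ^ n * 2 ^ n)) * n ^ (n / 2 * 2) * n.factorial ^ 2 := by rw [pow_mul]; ring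
      _ = 16 ^ n * n ^ (n / 2 * 2) * n.factorial ^ 2 := by simp only [← mul_pow]; norm_num
      _ ≤ _ := by
        have : n ^ (n / 2 * 2) ≤ n ^ n := Nat.pow_le_pow_right hn (by omega)
        gcongr
  have h3' : (X : ℝ) ^ 2 ≤ 16 ^ n * (n : ℝ) ^ n * (n.factorial : ℝ) ^ 2 := by exact_mod_cast h3
  have hf : (0 : ℝ) < n.factorial := by positivity
  have h4 : (n : ℝ) ^ n ≤ Real.exp 1 ^ n * n.factorial := by
    have := Real.pow_div_factorial_le_exp (n : ℝ) (by positivity) n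
    rw [div_le_iff₀ hf] at this
    rwa [← Real.exp_nat_mul, mul_one]
  rw [div_pow, div_le_div_iff₀ (by positivity) hf, mul_pow]
  calc (X : ℝ) ^ 2 * n.factorial ≤ 16 ^ n * (Real.exp 1 ^ n * n.factorial) * (n.factorial : ℝ) ^ 2 * n.factorial := by
        refine mul_le_mul_of_nonneg_right (h3'.trans ?_) hf.le
        gcongr
    _ = _ := by ring

/-- For `σ, τ` independent uniform on `S_n`, the probability that the commutator
`[σ,τ]` is a non-identity involution tends to 0, and the probability that it is a
non-trivial cyclic permutation (exactly one orbit of size at least 2) tends to 0.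
Geometrically: a random square-tiled surface asymptotically almost surely belongs
neither to a principal stratum nor to a minimal stratum. -/
theorem commutator_involution_and_cycle_probability :
    Filter.Tendsto (fun n : ℕ =>
        (Nat.card {p : Equiv.Perm (Fin n) × Equiv.Perm (Fin n) //
            (p.1 * p.2 * p.1⁻¹ * p.2⁻¹) * (p.1 * p.2 * p.1⁻¹ * p.2⁻¹) = 1 ∧
              p.1 * p.2 * p.1⁻¹ * p.2⁻¹ ≠ 1} : ℝ)
          / (n.factorial : ℝ) ^ 2)
      Filter.atTop (nhds 0) ∧
    Filter.Tendsto (fun n : ℕ =>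
        (Nat.card {p : Equiv.Perm (Fin n) × Equiv.Perm (Fin n) //
            Multiset.card (p.1 * p.2 * p.1⁻¹ * p.2⁻¹).cycleType = 1} : ℝ)
          / (n.factorial : ℝ) ^ 2)
      Filter.atTop (nhds 0) := by
  classical
  constructor
  · refine squeeze_zero (fun n => by positivity) (fun n => ?_) involT
    refine div_le_div_of_nonneg_right ?_ (by positivity)
    rw [Nat.card_eq_fintype_card, Fintype.card_subtype]
    refine Nat.cast_le.2 (Finset.card_le_card ?_)
    intro p hp
    simp only [Finset.mem_filter, Finset.mem_univ, true_and] at hp ⊢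
    exact hp.1
  · refine squeeze_zero (fun n => by positivity) (fun n => ?_) cycleT
    refine div_le_div_of_nonneg_right ?_ (by positivity)
    rw [Nat.card_eq_fintype_card, Fintype.card_subtype]
    refine Nat.cast_le.2 (Finset.card_le_card ?_)
    intro p hp
    simp only [Finset.mem_filter, Finset.mem_univ, true_and] at hp ⊢
    exact Equiv.Perm.card_cycleType_eq_one.1 hp
end

section
/- There is a constant C > 0 such that for all n ≥ 1, | Pr[ E_n ] − 1/e | ≤ C/n, where E_n is the event that the pair (σ,τ) of independent uniform random elements of S_n satisfies: either [σ,τ] has no fixed point, or every fixed point i of [σ,τ] satisfies σ(i) = i and τ(i) = i. (By the combinatorial characterization of holonomy tori, E_n is exactly the event that the random square-tiled surface S(σ,τ) is a holonomy torus, so the probability that a random n-square square-tiled surface is a holonomy torus is 1/e + O(1/n).) -/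
open Equiv Finset

set_option linter.unusedSectionVars false
namespace HT
variable {α : Type} [Fintype α] [DecidableEq α]

theorem swapSum (x : α) (S : Finset α) (G : Perm α → α)
    (hG : ∀ τ, ∀ z, z ∉ S → G (τ * swap x z) = G τ) (F : α → Perm α → ℝ) :
    ∑ z ∈ Sᶜ, ∑ τ : Perm α, (if τ x = G τ then F z τ else 0) =
    ∑ τ : Perm α, (if τ⁻¹ (G τ) ∉ S then F (τ⁻¹ (G τ)) (τ * swap x (τ⁻¹ (G τ))) else 0) := by
  have h1 : ∀ z ∈ Sᶜ, ∑ τ : Perm α, (if τ x = G τ then F z τ else 0) =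
      ∑ τ : Perm α, (if z = τ⁻¹ (G τ) then F z (τ * swap x z) else 0) := by
    intro z hz
    rw [mem_compl] at hz
    rw [← Equiv.sum_comp (Equiv.mulRight (swap x z))]
    refine Finset.sum_congr rfl fun τ _ => ?_
    simp only [Equiv.coe_mulRight, hG τ z hz, Perm.mul_apply, swap_apply_left,
      Perm.eq_inv_iff_eq]
  rw [Finset.sum_congr rfl h1, Finset.sum_comm]
  refine Finset.sum_congr rfl fun τ _ => ?_
  rw [Finset.sum_ite_eq']
  simp

theorem swapLe (x : α) (S : Finset α) (G : Perm α → α)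
    (hG : ∀ τ, ∀ z, z ∉ S → G (τ * swap x z) = G τ) (W : Perm α → ℝ) (hW : ∀ τ, 0 ≤ W τ)
    (hWi : ∀ τ, ∀ z, z ∉ S → W (τ * swap x z) = W τ) :
    ((Fintype.card α : ℝ) - #S) * ∑ τ : Perm α, (if τ x = G τ then W τ else 0) ≤ ∑ τ, W τ := by
  have h := swapSum x S G hG (fun _ => W)
  rw [Finset.sum_const, Finset.card_compl, nsmul_eq_mul, Nat.cast_sub (Finset.card_le_univ S)] at h
  rw [h]
  refine Finset.sum_le_sum fun τ _ => ?_
  by_cases h1 : τ⁻¹ (G τ) ∈ S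
  · simp only [h1, not_true_eq_false, if_false]; exact hW τ
  · simp only [h1, not_false_eq_true, if_true]; rw [hWi _ _ h1]

/-- number of permutations -/
noncomputable def NN (α : Type) [Fintype α] [DecidableEq α] : ℝ := ∑ _τ : Perm α, (1 : ℝ)

theorem NN_pos : 0 < NN α := by
  unfold NN; simp [Fintype.card_pos]

theorem cnt1 (x y : α) : (Fintype.card α : ℝ) * ∑ τ : Perm α, (if τ x = y then (1:ℝ) else 0) = NN α := by
  have h := swapSum x ∅ (fun _ => y) (by simp) (fun _ _ => 1)
  rw [Finset.sum_const, nsmul_eq_mul] at h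
  simpa [NN] using h

theorem cnt2 (x y : α) (hxy : x ≠ y) (u v : α) :
    ((Fintype.card α : ℝ) - 1) * ∑ τ : Perm α, (if τ x = u then (if τ y = v then (1:ℝ) else 0) else 0)
     ≤ ∑ τ : Perm α, (if τ y = v then (1:ℝ) else 0) := by
  have h := swapLe x {y} (fun _ => u) (by simp) (fun τ => if τ y = v then (1:ℝ) else 0)
    (fun τ => by positivity) (by
      intro τ z hz
      have : z ≠ y := by simpa using hz
      simp [swap_apply_of_ne_of_ne hxy.symm this.symm])
  simpa using h

/-- indicator of commuting at a point -/
def cm (σ τ : Perm α) (j : α) : ℝ := if σ (τ j) = τ (σ j) then 1 else 0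
/-- number of commuting points -/
def X (σ τ : Perm α) : ℕ := #{j | σ (τ j) = τ (σ j)}

theorem cm_nonneg (σ τ : Perm α) (j : α) : 0 ≤ cm σ τ j := by unfold cm; positivity
theorem cm_le (σ τ : Perm α) (j : α) : cm σ τ j ≤ 1 := by unfold cm; split_ifs <;> norm_num
theorem X_eq (σ τ : Perm α) : (X σ τ : ℝ) = ∑ j, cm σ τ j := by
  simp [X, cm]
theorem X_le (σ τ : Perm α) : (X σ τ : ℝ) ≤ Fintype.card α := by
  exact_mod_cast Finset.card_le_univ _

def zz (σ τ : Perm α) (j : α) : α := τ⁻¹ (σ (τ j))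
def tt (σ τ : Perm α) (j : α) : Perm α := τ * swap (σ j) (zz σ τ j)

theorem switch (σ : Perm α) (j : α) (hj : σ j ≠ j) (F : α → Perm α → ℝ) :
    ∑ z ∈ {j}ᶜ, ∑ τ : Perm α, cm σ τ j * F z τ =
    ∑ τ : Perm α, (if zz σ τ j ≠ j then F (zz σ τ j) (tt σ τ j) else 0) := by
  have h := swapSum (σ j) {j} (fun τ => σ (τ j)) (by
      intro τ z hz
      have : z ≠ j := by simpa using hz
      simp [swap_apply_of_ne_of_ne hj.symm this.symm]) F
  simp only [mem_singleton] at h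
  rw [show (∑ τ : Perm α, (if zz σ τ j ≠ j then F (zz σ τ j) (tt σ τ j) else 0)) = _ from h.symm]
  refine Finset.sum_congr rfl fun z _ => Finset.sum_congr rfl fun τ _ => ?_
  simp [cm, eq_comm]

theorem switch1 (σ : Perm α) (j : α) (hj : σ j ≠ j) (F : Perm α → ℝ) :
    ((Fintype.card α : ℝ) - 1) * ∑ τ : Perm α, cm σ τ j * F τ =
    ∑ τ : Perm α, (if zz σ τ j ≠ j then F (tt σ τ j) else 0) := by
  rw [← switch σ j hj (fun _ => F), Finset.sum_const, Finset.card_compl, nsmul_eq_mul, 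
    Nat.cast_sub (Finset.card_le_univ _)]
  simp

/-- indicator -/
def I (p : Prop) [Decidable p] : ℝ := if p then 1 else 0
theorem I_nonneg (p : Prop) [Decidable p] : 0 ≤ I p := by unfold I; positivity
theorem I_le (p : Prop) [Decidable p] : I p ≤ 1 := by unfold I; split_ifs <;> norm_num

theorem cnt1' (x y : α) : (Fintype.card α : ℝ) * ∑ τ : Perm α, I (τ x = y) = NN α := cnt1 x y

theorem fix2 (hn : 2 ≤ Fintype.card α) :
    ∑ j : α, ∑ y : α, ∑ σ : Perm α, I (σ j = j) * I (σ y = y) ≤ 3 * NN α := by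
  have hn' : (2:ℝ) ≤ Fintype.card α := by exact_mod_cast hn
  set n : ℝ := (Fintype.card α : ℝ)
  have key : ∀ j y : α, ∑ σ : Perm α, I (σ j = j) * I (σ y = y) ≤
      (if j = y then NN α / n else 0) + NN α / (n * (n-1)) := by
    intro j y
    have hN := NN_pos (α := α)
    have c1 := cnt1' y y
    have c1' : ∑ τ : Perm α, I (τ y = y) = NN α / n := by
      field_simp; linarith
    split_ifs with h
    · subst h
      have : ∑ σ : Perm α, I (σ j = j) * I (σ j = j) = NN α / n := by
        rw [← c1']
        refine Finset.sum_congr rfl fun σ _ => ?_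
        unfold I; split_ifs <;> simp
      rw [this]
      have : 0 ≤ NN α / (n * (n-1)) := div_nonneg hN.le (mul_nonneg (by linarith) (by linarith))
      linarith
    · have h2 := cnt2 j y h j y
      have e : ∑ σ : Perm α, I (σ j = j) * I (σ y = y) = 
        ∑ τ : Perm α, (if τ j = j then (if τ y = y then (1:ℝ) else 0) else 0) := by
        refine Finset.sum_congr rfl fun σ _ => ?_
        unfold I; split_ifs <;> simp
      have e2 : ∑ τ : Perm α, I (τ y = y) = ∑ τ : Perm α, (if τ y = y then (1:ℝ) else 0) := rfl
      rw [← e, ← e2, c1'] at h2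
      rw [zero_add, ← div_div, le_div_iff₀ (by linarith)]
      linarith
  calc _ ≤ ∑ j : α, ∑ y : α, ((if j = y then NN α / n else 0) + NN α / (n * (n-1))) :=
        Finset.sum_le_sum fun j _ => Finset.sum_le_sum fun y _ => key j y
    _ = NN α + n * NN α / (n-1) := by
        simp only [Finset.sum_add_distrib, Finset.sum_ite_eq, Finset.mem_univ, if_true, Finset.sum_const, Finset.card_univ, nsmul_eq_mul]
        have : n - 1 ≠ 0 := by intro h; linarith
        have : n ≠ 0 := by intro h; linarith
        change n * _ + n * (n * _) = _
        field_simp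
    _ ≤ _ := by
        have : n * NN α / (n-1) ≤ 2 * NN α := by
          rw [div_le_iff₀ (by linarith)]
          nlinarith [NN_pos (α := α)]
        linarith


theorem Q_le (hn : 2 ≤ Fintype.card α) :
    (Fintype.card α : ℝ) * ∑ σ : Perm α, ∑ j : α, I (σ j = j) * ∑ τ : Perm α, cm σ τ j ≤ 3 * NN α ^ 2 := by
  have key : ∀ σ : Perm α, ∀ j : α, (Fintype.card α : ℝ) * (I (σ j = j) * ∑ τ : Perm α, cm σ τ j)
      = NN α * ∑ y : α, I (σ j = j) * I (σ y = y) := by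
    intro σ j
    by_cases h : σ j = j
    · have e : ∑ τ : Perm α, cm σ τ j = ∑ y : α, ∑ τ : Perm α, I (τ j = y) * I (σ y = y) := by
        rw [Finset.sum_comm]
        refine Finset.sum_congr rfl fun τ _ => ?_
        simp only [cm, I, h, ite_mul, one_mul, zero_mul, Finset.sum_ite_eq, Finset.mem_univ, if_true]
      rw [e]
      simp only [← Finset.sum_mul]
      simp only [I, h, if_true, one_mul, Finset.mul_sum]
      refine Finset.sum_congr rfl fun y _ => ?_
      rw [← mul_assoc]
      congr 1
      exact cnt1 j y
    · simp [I, h]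
  calc _ = NN α * ∑ j : α, ∑ y : α, ∑ σ : Perm α, I (σ j = j) * I (σ y = y) := by
        simp only [Finset.mul_sum] at key ⊢
        simp only [key]
        rw [Finset.sum_comm]
        refine Finset.sum_congr rfl fun j _ => ?_
        rw [Finset.sum_comm]
    _ ≤ NN α * (3 * NN α) := mul_le_mul_of_nonneg_left (fix2 hn) NN_pos.le
    _ = _ := by ring

theorem cm_eq (σ τ : Perm α) (b z k : α) (h1 : k ≠ b) (h2 : k ≠ z) (h3 : σ k ≠ b) (h4 : σ k ≠ z) :
    (σ ((τ * swap b z) k) = (τ * swap b z) (σ k)) ↔ σ (τ k) = τ (σ k) := by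
  simp [swap_apply_of_ne_of_ne h1 h2, swap_apply_of_ne_of_ne h3 h4]

theorem X_le4 (σ τ : Perm α) (b z : α) : X σ (τ * swap b z) ≤ X σ τ + 4 := by
  have : ({k | σ ((τ * swap b z) k) = (τ * swap b z) (σ k)} : Finset α) ⊆
      ({k | σ (τ k) = τ (σ k)} : Finset α) ∪ {b, z, σ⁻¹ b, σ⁻¹ z} := by
    intro k hk
    rw [Finset.mem_filter] at hk
    by_contra hc
    simp only [Finset.mem_union, Finset.mem_filter, Finset.mem_insert, Finset.mem_singleton, Finset.mem_univ, true_and, not_or, Perm.eq_inv_iff_eq] at hc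
    exact hc.1 ((cm_eq σ τ b z k hc.2.1 hc.2.2.1 hc.2.2.2.1 hc.2.2.2.2).1 hk.2)
  refine (Finset.card_le_card this).trans ((Finset.card_union_le _ _).trans ?_)
  exact Nat.add_le_add_left Finset.card_le_four _

theorem X_succ (σ τ : Perm α) (j : α) (hj : σ j ≠ j) (hz : zz σ τ j ≠ j)
    (h0 : ¬ σ (τ j) = τ (σ j))
    (h1 : ¬ σ (τ (σ j)) = τ (σ (σ j)))
    (h2 : ¬ σ (τ (zz σ τ j)) = τ (σ (zz σ τ j)))
    (h3 : ¬ σ (τ (σ⁻¹ (zz σ τ j))) = τ (σ (σ⁻¹ (zz σ τ j))))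
    (h1' : ¬ σ (tt σ τ j (σ j)) = tt σ τ j (σ (σ j)))
    (h2' : ¬ σ (tt σ τ j (zz σ τ j)) = tt σ τ j (σ (zz σ τ j)))
    (h3' : ¬ σ (tt σ τ j (σ⁻¹ (zz σ τ j))) = tt σ τ j (σ (σ⁻¹ (zz σ τ j)))) :
    X σ (tt σ τ j) = X σ τ + 1 := by
  have hjj : σ (tt σ τ j j) = tt σ τ j (σ j) := by
    simp only [tt, Perm.mul_apply, swap_apply_left, swap_apply_of_ne_of_ne hj.symm hz.symm]
    simp [zz]
  have e : ({k | σ (tt σ τ j k) = tt σ τ j (σ k)} : Finset α) = 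
      insert j ({k | σ (τ k) = τ (σ k)} : Finset α) := by
    ext k
    simp only [Finset.mem_filter, Finset.mem_univ, true_and, Finset.mem_insert]
    by_cases k1 : k = j
    · subst k1; simp [hjj]
    by_cases k2 : k = σ j
    · subst k2; simp [h1, h1', hj]
    by_cases k3 : k = zz σ τ j
    · rw [k3]; simp [h2, h2', hz]
    by_cases k4 : k = σ⁻¹ (zz σ τ j)
    · rw [← k4] at h3 h3'
      simp [h3, h3', k1]
    simp only [k1, false_or]
    exact cm_eq σ τ _ _ k k2 k3 (fun h => k1 (σ.injective h)) (fun h => k4 (by rw [← h]; simp))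
  unfold X
  rw [e, Finset.card_insert_of_notMem (by simpa using h0)]

theorem f_diff (f : ℕ → ℝ) (hf0 : ∀ k, 0 ≤ f k) (hf1 : ∀ k, f k ≤ 1)
    (σ τ : Perm α) (j : α) (hj : σ j ≠ j) (hz : zz σ τ j ≠ j) :
    |f (X σ (tt σ τ j)) - f (X σ τ + 1)| ≤
      (cm σ τ j + cm σ τ (σ j) + cm σ τ (zz σ τ j) + cm σ τ (σ⁻¹ (zz σ τ j))) +
      (cm σ (tt σ τ j) (σ j) + cm σ (tt σ τ j) (zz σ τ j) + cm σ (tt σ τ j) (σ⁻¹ (zz σ τ j))) := by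
  have p0 := cm_nonneg σ τ j
  have p1 := cm_nonneg σ τ (σ j)
  have p2 := cm_nonneg σ τ (zz σ τ j)
  have p3 := cm_nonneg σ τ (σ⁻¹ (zz σ τ j))
  have p4 := cm_nonneg σ (tt σ τ j) (σ j)
  have p5 := cm_nonneg σ (tt σ τ j) (zz σ τ j)
  have p6 := cm_nonneg σ (tt σ τ j) (σ⁻¹ (zz σ τ j))
  have hle : |f (X σ (tt σ τ j)) - f (X σ τ + 1)| ≤ 1 := by
    rw [abs_le]
    constructor <;> linarith [hf0 (X σ (tt σ τ j)), hf1 (X σ (tt σ τ j)), hf0 (X σ τ + 1), hf1 (X σ τ + 1)]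
  have c1 : ∀ (τ : Perm α) k, σ (τ k) = τ (σ k) → cm σ τ k = 1 := fun τ k h => by simp [cm, h]
  by_cases h0 : σ (τ j) = τ (σ j)
  · have := c1 _ _ h0; linarith
  by_cases h1 : σ (τ (σ j)) = τ (σ (σ j))
  · have := c1 _ _ h1; linarith
  by_cases h2 : σ (τ (zz σ τ j)) = τ (σ (zz σ τ j))
  · have := c1 _ _ h2; linarith
  by_cases h3 : σ (τ (σ⁻¹ (zz σ τ j))) = τ (σ (σ⁻¹ (zz σ τ j)))
  · have := c1 _ _ h3; linarith
  by_cases h4 : σ (tt σ τ j (σ j)) = tt σ τ j (σ (σ j))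
  · have := c1 _ _ h4; linarith
  by_cases h5 : σ (tt σ τ j (zz σ τ j)) = tt σ τ j (σ (zz σ τ j))
  · have := c1 _ _ h5; linarith
  by_cases h6 : σ (tt σ τ j (σ⁻¹ (zz σ τ j))) = tt σ τ j (σ (σ⁻¹ (zz σ τ j)))
  · have := c1 _ _ h6; linarith
  rw [X_succ σ τ j hj hz h0 h1 h2 h3 h4 h5 h6]
  simp only [sub_self, abs_zero]
  positivity

/-- sum over pairs -/
def AA (F : Perm α → Perm α → ℝ) : ℝ := ∑ σ : Perm α, ∑ τ : Perm α, F σ τ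

theorem NNcard : (Fintype.card (Perm α) : ℝ) = NN α := by simp [NN]
theorem sumN (c : ℝ) : ∑ _τ : Perm α, c = NN α * c := by
  simp [NN]

theorem EX (hn : 2 ≤ Fintype.card α) : AA (fun σ τ : Perm α => (X σ τ : ℝ)) ≤ 4 * NN α ^ 2 := by
  have hn' : (2:ℝ) ≤ Fintype.card α := by exact_mod_cast hn
  have hQ := Q_le hn
  have hN := NN_pos (α := α)
  set n : ℝ := (Fintype.card α : ℝ) with hnd
  have key : ∀ σ : Perm α, ∀ j, ∑ τ : Perm α, cm σ τ j ≤ 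
      I (σ j = j) * ∑ τ : Perm α, cm σ τ j + NN α / (n - 1) := by
    intro σ j
    by_cases h : σ j = j
    · have : 0 ≤ NN α / (n-1) := div_nonneg hN.le (by linarith)
      simp [I, h, this]
    · have h1 := switch1 σ j h (fun _ => 1)
      simp only [mul_one] at h1
      rw [← hnd] at h1
      have : ∑ τ : Perm α, (if zz σ τ j ≠ j then (1:ℝ) else 0) ≤ NN α := 
        Finset.sum_le_sum fun τ _ => by split_ifs <;> norm_num
      have : ∑ τ : Perm α, cm σ τ j ≤ NN α / (n - 1) := by
        rw [le_div_iff₀ (by linarith)]; linarith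
      simpa [I, h] using this
  have e : AA (fun σ τ : Perm α => (X σ τ : ℝ)) = ∑ σ : Perm α, ∑ j, ∑ τ : Perm α, cm σ τ j := by
    unfold AA
    refine Finset.sum_congr rfl fun σ _ => ?_
    rw [Finset.sum_comm]
    exact Finset.sum_congr rfl fun τ _ => X_eq σ τ
  rw [e]
  refine (Finset.sum_le_sum fun σ _ => Finset.sum_le_sum fun j _ => key σ j).trans ?_
  simp only [Finset.sum_add_distrib, Finset.sum_const, Finset.card_univ, nsmul_eq_mul, NNcard]
  rw [← hnd]
  have a1 : n * (NN α / (n-1)) ≤ 2 * NN α := by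
    rw [← mul_div_assoc, div_le_iff₀ (by linarith)]
    nlinarith
  have a2 := mul_le_mul_of_nonneg_left a1 hN.le
  set Q := ∑ σ : Perm α, ∑ j : α, I (σ j = j) * ∑ τ : Perm α, cm σ τ j
  have hQ0 : 0 ≤ Q := Finset.sum_nonneg fun σ _ => Finset.sum_nonneg fun j _ => 
    mul_nonneg (I_nonneg _) (Finset.sum_nonneg fun τ _ => cm_nonneg _ _ _)
  nlinarith

theorem EX2 (hn : 2 ≤ Fintype.card α) : AA (fun σ τ : Perm α => (X σ τ : ℝ) ^ 2) ≤ 19 * NN α ^ 2 := by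
  have hn' : (2:ℝ) ≤ Fintype.card α := by exact_mod_cast hn
  have hQ := Q_le hn
  have hX := EX hn
  have hN := NN_pos (α := α)
  set n : ℝ := (Fintype.card α : ℝ) with hnd
  have key : ∀ σ : Perm α, ∀ j, ∑ τ : Perm α, cm σ τ j * X σ τ ≤ 
      n * (I (σ j = j) * ∑ τ : Perm α, cm σ τ j) + (∑ τ : Perm α, ((X σ τ : ℝ) + 4)) / (n - 1) := by
    intro σ j
    have hp : 0 ≤ ∑ τ : Perm α, ((X σ τ : ℝ) + 4) := Finset.sum_nonneg fun τ _ => by positivity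
    by_cases h : σ j = j
    · have : 0 ≤ (∑ τ : Perm α, ((X σ τ : ℝ) + 4)) / (n-1) := div_nonneg hp (by linarith)
      have h2 : ∑ τ : Perm α, cm σ τ j * X σ τ ≤ n * ∑ τ : Perm α, cm σ τ j := by
        rw [Finset.mul_sum]
        refine Finset.sum_le_sum fun τ _ => ?_
        rw [mul_comm]
        exact mul_le_mul_of_nonneg_right (X_le σ τ) (cm_nonneg _ _ _)
      simp only [I, h, if_true, one_mul]
      linarith
    · have h1 := switch1 σ j h (fun τ => X σ τ)
      rw [← hnd] at h1
      have : ∑ τ : Perm α, (if zz σ τ j ≠ j then (X σ (tt σ τ j) : ℝ) else 0) ≤ ∑ τ : Perm α, ((X σ τ : ℝ) + 4) := 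
        Finset.sum_le_sum fun τ _ => by 
          split_ifs 
          · exact_mod_cast X_le4 σ τ _ _
          · positivity
      have : ∑ τ : Perm α, cm σ τ j * X σ τ ≤ (∑ τ : Perm α, ((X σ τ : ℝ) + 4)) / (n - 1) := by
        rw [le_div_iff₀ (by linarith)]; linarith
      simpa [I, h] using this
  have e : AA (fun σ τ : Perm α => (X σ τ : ℝ) ^ 2) = ∑ σ : Perm α, ∑ j, ∑ τ : Perm α, cm σ τ j * X σ τ := by
    unfold AA
    refine Finset.sum_congr rfl fun σ _ => ?_
    rw [Finset.sum_comm]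
    refine Finset.sum_congr rfl fun τ _ => ?_
    rw [← Finset.sum_mul, ← X_eq]; exact sq _
  rw [e]
  refine (Finset.sum_le_sum fun σ _ => Finset.sum_le_sum fun j _ => key σ j).trans ?_
  simp only [Finset.sum_add_distrib, Finset.sum_const, Finset.card_univ, nsmul_eq_mul, NNcard, ← Finset.mul_sum, ← Finset.sum_div]
  rw [← hnd]
  change _ + n * ((AA (fun σ τ : Perm α => (X σ τ : ℝ)) + _) / _) ≤ _
  have a1 : n * ((AA (fun σ τ : Perm α => (X σ τ : ℝ)) + NN α * (NN α * 4)) / (n-1)) ≤ 16 * NN α ^ 2 := by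
    rw [← mul_div_assoc, div_le_iff₀ (by linarith)]
    nlinarith
  linarith
theorem two_cyc (hn : 2 ≤ Fintype.card α) (j : α) :
    ((Fintype.card α : ℝ) - 1) * ∑ σ : Perm α, I (σ j ≠ j) * I (σ (σ j) = j) ≤ NN α := by
  have hn' : (2:ℝ) ≤ Fintype.card α := by exact_mod_cast hn
  have e : ∑ σ : Perm α, I (σ j ≠ j) * I (σ (σ j) = j) = 
      ∑ y ∈ {j}ᶜ, ∑ σ : Perm α, (if σ y = j then (if σ j = y then (1:ℝ) else 0) else 0) := by
    rw [Finset.sum_comm]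
    refine Finset.sum_congr rfl fun σ _ => ?_
    have : ∀ y, (if σ y = j then (if σ j = y then (1:ℝ) else 0) else 0) = 
      if σ j = y then (if σ (σ j) = j then (1:ℝ) else 0) else 0 := by
      intro y
      by_cases h : σ j = y
      · simp [h]
      · simp [h]
    simp only [this, Finset.sum_ite_eq, Finset.mem_compl, Finset.mem_singleton, I]
    split_ifs <;> simp_all
  have e3 : NN α = ∑ y : α, ∑ σ : Perm α, (if σ j = y then (1:ℝ) else 0) := by
    rw [Finset.sum_comm]
    simp [NN]
  rw [e, Finset.mul_sum, e3]
  refine (Finset.sum_le_sum fun y hy => ?_).trans 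
    (Finset.sum_le_sum_of_subset_of_nonneg (Finset.subset_univ {j}ᶜ) fun y _ _ => Finset.sum_nonneg fun σ _ => by positivity)
  exact cnt2 y j (by simpa using hy) j y

theorem RR_le (hn : 2 ≤ Fintype.card α) :
    ((Fintype.card α : ℝ) - 1) * ∑ σ : Perm α, ∑ j : α, I (σ j ≠ j) * ∑ τ : Perm α, cm σ τ j * cm σ τ (σ j) ≤ 
      8 * NN α ^ 2 := by
  have hn' : (2:ℝ) ≤ Fintype.card α := by exact_mod_cast hn
  have hX := EX hn
  have hN := NN_pos (α := α)
  have h2 := two_cyc hn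
  set n : ℝ := (Fintype.card α : ℝ) with hnd
  have key : ∀ σ : Perm α, ∀ j, (n - 1) * (I (σ j ≠ j) * ∑ τ : Perm α, cm σ τ j * cm σ τ (σ j)) ≤
      ∑ τ : Perm α, cm σ τ j + NN α * (I (σ j ≠ j) * I (σ (σ j) = j)) + NN α / (n-1) := by
    intro σ j
    by_cases h : σ j = j
    · have a1 : 0 ≤ NN α / (n-1) := div_nonneg hN.le (by linarith)
      have a2 : 0 ≤ ∑ τ : Perm α, cm σ τ j := Finset.sum_nonneg fun τ _ => cm_nonneg _ _ _
      simp only [I, h, ne_eq, not_true_eq_false, if_false]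
      linarith
    · have hk : σ (σ j) ≠ σ j := fun h' => h (σ.injective h')
      have s1 := switch1 σ (σ j) hk (fun τ => cm σ τ j)
      rw [← hnd] at s1
      have s2 : ∑ τ : Perm α, (if zz σ τ (σ j) ≠ σ j then cm σ (tt σ τ (σ j)) j else 0) ≤
          ∑ τ : Perm α, (cm σ τ j + I (σ (σ j) = j) + (if τ j = σ (τ (σ j)) then 1 else 0)) := by
        refine Finset.sum_le_sum fun τ _ => ?_
        have p1 := cm_nonneg σ τ j
        have p2 := I_nonneg (σ (σ j) = j)
        have p3 : (0:ℝ) ≤ (if τ j = σ (τ (σ j)) then 1 else 0) := by positivity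
        have p4 := cm_le σ (tt σ τ (σ j)) j
        split_ifs with c1 c2
        · linarith
        · by_cases c3 : σ (σ j) = j
          · have : I (σ (σ j) = j) = 1 := by simp [I, c3]
            linarith
          · have c4 : j ≠ zz σ τ (σ j) := by
              intro h'; apply c2; unfold zz at h'
              exact Perm.eq_inv_iff_eq.1 h'
            have : cm σ (tt σ τ (σ j)) j = cm σ τ j := by
              unfold cm
              simp only [tt, cm_eq σ τ _ _ j (Ne.symm c3) c4 hk.symm c1.symm]
            linarith
        · linarith
        · linarith
      have s3 := swapLe j {σ j} (fun τ => σ (τ (σ j))) (by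
        intro τ z hz
        have : z ≠ σ j := by simpa using hz
        simp [swap_apply_of_ne_of_ne h this.symm]) (fun _ => 1) (by simp) (by simp)
      simp only [Finset.card_singleton, Nat.cast_one] at s3
      rw [← hnd] at s3
      have s4 : ∑ τ : Perm α, (if τ j = σ (τ (σ j)) then (1:ℝ) else 0) ≤ NN α / (n-1) := by
        rw [le_div_iff₀ (by linarith), mul_comm]; exact s3
      simp only [Finset.sum_add_distrib, sumN] at s2
      have : I (σ j ≠ j) = 1 := by simp [I, h]
      rw [this, one_mul, one_mul]
      have s5 : ∑ τ : Perm α, cm σ τ j * cm σ τ (σ j) = ∑ τ : Perm α, cm σ τ (σ j) * cm σ τ j :=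
        Finset.sum_congr rfl fun τ _ => mul_comm _ _
      rw [s5, s1]
      linarith
  have e : AA (fun σ τ : Perm α => (X σ τ : ℝ)) = ∑ σ : Perm α, ∑ j, ∑ τ : Perm α, cm σ τ j := by
    unfold AA
    refine Finset.sum_congr rfl fun σ _ => ?_
    rw [Finset.sum_comm]
    exact Finset.sum_congr rfl fun τ _ => X_eq σ τ
  have t2 : ∑ σ : Perm α, ∑ j, NN α * (I (σ j ≠ j) * I (σ (σ j) = j)) ≤ 2 * NN α ^ 2 := by
    rw [Finset.sum_comm]
    calc _ ≤ ∑ j : α, NN α * (NN α / (n-1)) := by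
          refine Finset.sum_le_sum fun j _ => ?_
          rw [← Finset.mul_sum]
          refine mul_le_mul_of_nonneg_left ?_ hN.le
          rw [le_div_iff₀ (by linarith), mul_comm]; exact h2 j
      _ = NN α * (n * NN α / (n-1)) := by
          rw [Finset.sum_const, Finset.card_univ, nsmul_eq_mul, ← hnd]; ring
      _ ≤ NN α * (2 * NN α) := by
          refine mul_le_mul_of_nonneg_left ?_ hN.le
          rw [div_le_iff₀ (by linarith)]
          nlinarith
      _ = _ := by ring
  have t3 : NN α * (n * (NN α / (n-1))) ≤ 2 * NN α ^ 2 := by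
    calc _ ≤ NN α * (2 * NN α) := by
          refine mul_le_mul_of_nonneg_left ?_ hN.le
          rw [← mul_div_assoc, div_le_iff₀ (by linarith)]
          nlinarith
      _ = _ := by ring
  simp only [Finset.mul_sum (a := n - 1)]
  refine (Finset.sum_le_sum fun σ _ => Finset.sum_le_sum fun j _ => key σ j).trans ?_
  simp only [Finset.sum_add_distrib, ← e]
  simp only [Finset.sum_const, Finset.card_univ, nsmul_eq_mul, NNcard]
  rw [← hnd]
  linarith

theorem T_le (f : ℕ → ℝ) (hf0 : ∀ k, 0 ≤ f k) (hf1 : ∀ k, f k ≤ 1) (hn : 2 ≤ Fintype.card α)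
    (σ : Perm α) (j : α) :
    |((Fintype.card α : ℝ) - 1) * ∑ τ : Perm α, cm σ τ j * f (X σ τ) - ∑ τ : Perm α, f (X σ τ + 1)| ≤
    ((Fintype.card α : ℝ) * (I (σ j = j) * ∑ τ : Perm α, cm σ τ j) + NN α * I (σ j = j)) +
    ∑ τ : Perm α, (I (zz σ τ j = j) + 
      (cm σ τ j + cm σ τ (σ j) + cm σ τ (zz σ τ j) + cm σ τ (σ⁻¹ (zz σ τ j)))) +
    (((Fintype.card α : ℝ) - 1) * (I (σ j ≠ j) * ∑ τ : Perm α, cm σ τ j * cm σ τ (σ j)) + 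
     2 * ∑ τ : Perm α, cm σ τ j * X σ τ) := by
  have hn' : (2:ℝ) ≤ Fintype.card α := by exact_mod_cast hn
  have hN := NN_pos (α := α)
  have hB : 0 ≤ ∑ τ : Perm α, (I (zz σ τ j = j) + 
      (cm σ τ j + cm σ τ (σ j) + cm σ τ (zz σ τ j) + cm σ τ (σ⁻¹ (zz σ τ j)))) := by
    refine Finset.sum_nonneg fun τ _ => ?_
    have := I_nonneg (zz σ τ j = j)
    have := cm_nonneg σ τ
    have := this j
    have := cm_nonneg σ τ (σ j)
    have := cm_nonneg σ τ (zz σ τ j)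
    have := cm_nonneg σ τ (σ⁻¹ (zz σ τ j))
    linarith
  have hX0 : 0 ≤ ∑ τ : Perm α, cm σ τ j * X σ τ := Finset.sum_nonneg fun τ _ => 
    mul_nonneg (cm_nonneg _ _ _) (by positivity)
  have hC : 0 ≤ ∑ τ : Perm α, cm σ τ j := Finset.sum_nonneg fun τ _ => cm_nonneg _ _ _
  by_cases h : σ j = j
  · have i1 : I (σ j = j) = 1 := by simp [I, h]
    have i2 : I (σ j ≠ j) = 0 := by simp [I, h]
    rw [i1, i2]
    have a1 : ∑ τ : Perm α, cm σ τ j * f (X σ τ) ≤ ∑ τ : Perm α, cm σ τ j := 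
      Finset.sum_le_sum fun τ _ => mul_le_of_le_one_right (cm_nonneg _ _ _) (hf1 _)
    have a2 : 0 ≤ ∑ τ : Perm α, cm σ τ j * f (X σ τ) := 
      Finset.sum_nonneg fun τ _ => mul_nonneg (cm_nonneg _ _ _) (hf0 _)
    have a3 : ∑ τ : Perm α, f (X σ τ + 1) ≤ NN α := Finset.sum_le_sum fun τ _ => hf1 _
    have a4 : 0 ≤ ∑ τ : Perm α, f (X σ τ + 1) := Finset.sum_nonneg fun τ _ => hf0 _
    rw [abs_le]
    constructor <;> nlinarith
  · have i1 : I (σ j = j) = 0 := by simp [I, h]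
    have i2 : I (σ j ≠ j) = 1 := by simp [I, h]
    rw [i1, i2, switch1 σ j h (fun τ => f (X σ τ)), ← Finset.sum_sub_distrib]
    have sw := switch σ j h (fun z τ => cm σ τ (σ j) + cm σ τ z + cm σ τ (σ⁻¹ z))
    have swle : ∑ z ∈ {j}ᶜ, ∑ τ : Perm α, cm σ τ j * (cm σ τ (σ j) + cm σ τ z + cm σ τ (σ⁻¹ z)) ≤
        ((Fintype.card α : ℝ) - 1) * (∑ τ : Perm α, cm σ τ j * cm σ τ (σ j)) + 
          2 * ∑ τ : Perm α, cm σ τ j * X σ τ := by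
      rw [Finset.sum_comm, Finset.mul_sum, Finset.mul_sum, ← Finset.sum_add_distrib]
      refine Finset.sum_le_sum fun τ _ => ?_
      rw [← Finset.mul_sum, Finset.sum_add_distrib, Finset.sum_add_distrib, Finset.sum_const, 
        Finset.card_compl, nsmul_eq_mul, Nat.cast_sub (Finset.card_le_univ _)]
      have b1 : ∑ z ∈ {j}ᶜ, cm σ τ z ≤ X σ τ := by
        rw [X_eq]
        exact Finset.sum_le_sum_of_subset_of_nonneg (Finset.subset_univ _) fun y _ _ => cm_nonneg _ _ _
      have b2 : ∑ z ∈ {j}ᶜ, cm σ τ (σ⁻¹ z) ≤ X σ τ := by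
        rw [X_eq, ← Equiv.sum_comp σ⁻¹]
        exact Finset.sum_le_sum_of_subset_of_nonneg (Finset.subset_univ _) fun y _ _ => cm_nonneg _ _ _
      have b3 := cm_nonneg σ τ j
      simp only [Finset.card_singleton, Nat.cast_one]
      nlinarith
    rw [sw] at swle
    have main : |∑ τ : Perm α, ((if zz σ τ j ≠ j then f (X σ (tt σ τ j)) else 0) - f (X σ τ + 1))| ≤
      ∑ τ : Perm α, ((I (zz σ τ j = j) + 
      (cm σ τ j + cm σ τ (σ j) + cm σ τ (zz σ τ j) + cm σ τ (σ⁻¹ (zz σ τ j)))) + 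
      (if zz σ τ j ≠ j then cm σ (tt σ τ j) (σ j) + cm σ (tt σ τ j) (zz σ τ j) + cm σ (tt σ τ j) (σ⁻¹ (zz σ τ j)) else 0)) := by
      refine (Finset.abs_sum_le_sum_abs _ _).trans (Finset.sum_le_sum fun τ _ => ?_)
      by_cases hz : zz σ τ j = j
      · have i3 : I (zz σ τ j = j) = 1 := by simp [I, hz]
        have q1 := cm_nonneg σ τ j
        have q2 := cm_nonneg σ τ (σ j)
        have q3 := cm_nonneg σ τ (zz σ τ j)
        have q4 := cm_nonneg σ τ (σ⁻¹ (zz σ τ j))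
        rw [i3, if_neg (by simpa using hz), if_neg (by simpa using hz), abs_le]
        constructor <;> linarith [hf0 (X σ τ + 1), hf1 (X σ τ + 1)]
      · rw [if_pos hz, if_pos hz]
        have := f_diff f hf0 hf1 σ τ j h hz
        have := I_nonneg (zz σ τ j = j)
        linarith
    rw [Finset.sum_add_distrib] at main
    linarith

theorem main_le (f : ℕ → ℝ) (hf0 : ∀ k, 0 ≤ f k) (hf1 : ∀ k, f k ≤ 1) (hn : 2 ≤ Fintype.card α) :
    ((Fintype.card α : ℝ) - 1) * |AA (fun σ τ : Perm α => X σ τ * f (X σ τ) - f (X σ τ + 1))| ≤ 70 * NN α ^ 2 := by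
  have hn' : (2:ℝ) ≤ Fintype.card α := by exact_mod_cast hn
  have hN := NN_pos (α := α)
  have hX := EX hn
  have hX2 := EX2 hn
  have hR := RR_le hn
  have hQ := Q_le hn
  have hT := T_le f hf0 hf1 hn
  have c1 := cnt1' (α := α)
  set n : ℝ := (Fintype.card α : ℝ) with hnd
  have e1 : ∑ σ : Perm α, ∑ j, ((n - 1) * ∑ τ : Perm α, cm σ τ j * f (X σ τ) - ∑ τ : Perm α, f (X σ τ + 1)) =
      (n-1) * AA (fun σ τ : Perm α => X σ τ * f (X σ τ) - f (X σ τ + 1)) - AA (fun σ τ : Perm α => f (X σ τ + 1)) := by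
    unfold AA
    rw [Finset.mul_sum, ← Finset.sum_sub_distrib]
    refine Finset.sum_congr rfl fun σ _ => ?_
    rw [Finset.sum_sub_distrib, ← Finset.mul_sum, Finset.sum_comm, Finset.sum_const, Finset.card_univ, nsmul_eq_mul, ← hnd,
      Finset.sum_sub_distrib]
    simp only [← Finset.sum_mul, ← X_eq]
    ring
  have e2 : |AA (fun σ τ : Perm α => f (X σ τ + 1))| ≤ NN α ^ 2 := by
    have p0 : 0 ≤ AA (fun σ τ : Perm α => f (X σ τ + 1)) := Finset.sum_nonneg fun σ _ => Finset.sum_nonneg fun τ _ => hf0 _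
    rw [abs_of_nonneg p0]
    calc _ ≤ ∑ σ : Perm α, ∑ τ : Perm α, (1:ℝ) := Finset.sum_le_sum fun σ _ => Finset.sum_le_sum fun τ _ => hf1 _
      _ = _ := by rw [sumN, sumN]; ring
  have e : ∑ σ : Perm α, ∑ j, ∑ τ : Perm α, cm σ τ j = AA (fun σ τ : Perm α => (X σ τ : ℝ)) := by
    unfold AA
    refine Finset.sum_congr rfl fun σ _ => ?_
    rw [Finset.sum_comm]
    exact Finset.sum_congr rfl fun τ _ => (X_eq σ τ).symm
  have g : ∀ (p : Perm α → Perm α → Perm α), ∑ σ : Perm α, ∑ j, ∑ τ : Perm α, cm σ τ (p σ τ j) = AA (fun σ τ : Perm α => (X σ τ : ℝ)) := by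
    intro p
    unfold AA
    refine Finset.sum_congr rfl fun σ _ => ?_
    rw [Finset.sum_comm]
    refine Finset.sum_congr rfl fun τ _ => ?_
    exact (Equiv.sum_comp (p σ τ) (cm σ τ)).trans (X_eq σ τ).symm
  have g2 : ∑ σ : Perm α, ∑ j, ∑ τ : Perm α, cm σ τ j * X σ τ = AA (fun σ τ : Perm α => (X σ τ : ℝ) ^ 2) := by
    unfold AA
    refine Finset.sum_congr rfl fun σ _ => ?_
    rw [Finset.sum_comm]
    refine Finset.sum_congr rfl fun τ _ => ?_
    rw [← Finset.sum_mul, ← X_eq]; exact (sq _).symm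
  have g3 : ∑ σ : Perm α, ∑ j : α, NN α * I (σ j = j) = NN α ^ 2 := by
    rw [Finset.sum_comm]
    have : ∀ j : α, ∑ σ : Perm α, NN α * I (σ j = j) = NN α * (NN α / n) := by
      intro j
      rw [← Finset.mul_sum, ← c1 j j]
      congr 1
      field_simp
    simp only [this, Finset.sum_const, Finset.card_univ, nsmul_eq_mul, ← hnd]
    field_simp
  have g4 : ∑ σ : Perm α, ∑ j : α, ∑ τ : Perm α, I (zz σ τ j = j) = NN α ^ 2 := by
    have : ∀ σ τ : Perm α, ∀ j, I (zz σ τ j = j) = I (σ (τ j) = τ j) := by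
      intro σ τ j
      simp only [I, zz, Perm.inv_eq_iff_eq]
    rw [Finset.sum_comm]
    have h4 : ∀ j : α, ∑ σ : Perm α, ∑ τ : Perm α, I (zz σ τ j = j) = NN α * (NN α / n) := by
      intro j
      rw [Finset.sum_comm]
      have : ∀ τ : Perm α, ∑ σ : Perm α, I (zz σ τ j = j) = NN α / n := by
        intro τ
        simp only [this]
        rw [← c1 (τ j) (τ j)]
        field_simp
      simp only [this, sumN]
    simp only [h4, Finset.sum_const, Finset.card_univ, nsmul_eq_mul, ← hnd]
    field_simp
  have big := (Finset.abs_sum_le_sum_abs _ _).trans (Finset.sum_le_sum fun σ (_ : σ ∈ (Finset.univ : Finset (Perm α))) => 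
    (Finset.abs_sum_le_sum_abs _ _).trans (Finset.sum_le_sum fun j (_ : j ∈ (Finset.univ : Finset α)) => hT σ j))
  rw [e1] at big
  have k1 := g (fun σ τ => σ)
  have k2 : ∑ σ : Perm α, ∑ j, ∑ τ : Perm α, cm σ τ (zz σ τ j) = _ := g (fun σ τ => τ⁻¹ * (σ * τ))
  have k3 : ∑ σ : Perm α, ∑ j, ∑ τ : Perm α, cm σ τ (σ⁻¹ (zz σ τ j)) = _ := g (fun σ τ => σ⁻¹ * (τ⁻¹ * (σ * τ)))
  simp only [Finset.sum_add_distrib, e, k1, k2, k3, g3, g4] at big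
  simp only [← Finset.mul_sum (a := (2:ℝ)), ← Finset.mul_sum (a := n), ← Finset.mul_sum (a := n - 1), g2] at big
  have tri := abs_sub_abs_le_abs_sub ((n-1) * AA (fun σ τ : Perm α => X σ τ * f (X σ τ) - f (X σ τ + 1))) (AA (fun σ τ : Perm α => f (X σ τ + 1)))
  rw [abs_mul, abs_of_nonneg (show 0 ≤ n - 1 by linarith)] at tri
  have hN2 : 0 < NN α ^ 2 := by positivity
  linarith

/-- Stein solution -/
noncomputable def stein : ℕ → ℝ
  | 0 => 0
  | k + 1 => k.factorial * (1 - (Real.exp 1)⁻¹ * ∑ i ∈ range (k + 1), (1 / (i.factorial : ℝ)))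

theorem stein_rec (k : ℕ) : stein (k+1) - k * stein k = (if k = 0 then 1 else 0) - (Real.exp 1)⁻¹ := by
  cases k with
  | zero => simp [stein]
  | succ k =>
    simp only [stein]
    rw [Finset.sum_range_succ _ (k+1), Nat.factorial_succ]
    have : (k.factorial : ℝ) ≠ 0 := by positivity
    have h2 : ((k:ℝ)+1) ≠ 0 := by positivity
    rw [if_neg (Nat.succ_ne_zero k)]
    push_cast
    rw [zero_sub]
    field_simp
    ring

theorem stein_nonneg (k : ℕ) : 0 ≤ stein k := by
  cases k with
  | zero => simp [stein]
  | succ k =>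
    have h := Real.sum_le_exp_of_nonneg (x := 1) (by norm_num) (k+1)
    simp only [one_pow] at h
    refine mul_nonneg (by positivity) ?_
    rw [sub_nonneg, inv_mul_le_iff₀ (Real.exp_pos 1)]
    linarith

theorem stein_le (k : ℕ) : stein k ≤ 1 := by
  cases k with
  | zero => simp [stein]
  | succ k =>
    have h := (abs_le.1 (Real.exp_bound (x := 1) (by norm_num) (n := k+1) (by omega))).2
    simp only [one_pow, abs_one, one_mul] at h
    have e2 : (2:ℝ) ≤ Real.exp 1 := by linarith [Real.add_one_le_exp (1:ℝ)]
    have he := Real.exp_pos 1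
    have hk : (0:ℝ) < k.factorial := by positivity
    simp only [stein]
    have e3 : (k.factorial : ℝ) * (1 - (Real.exp 1)⁻¹ * ∑ i ∈ range (k + 1), (1 / (i.factorial : ℝ))) = 
      (k.factorial * (Real.exp 1 - ∑ i ∈ range (k + 1), (1 / (i.factorial : ℝ)))) / Real.exp 1 := by
      field_simp
    rw [e3, div_le_one he]
    refine le_trans ?_ e2
    refine (mul_le_mul_of_nonneg_left h hk.le).trans ?_
    rw [Nat.factorial_succ]
    push_cast
    rw [← mul_div_assoc, div_le_iff₀ (by positivity)]
    have : (0:ℝ) ≤ k := by positivity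
    nlinarith [mul_nonneg hk.le this, mul_nonneg (mul_nonneg hk.le this) this]

theorem zero_le (hn : 2 ≤ Fintype.card α) :
    ((Fintype.card α : ℝ) - 1) * |AA (fun σ τ : Perm α => if X σ τ = 0 then 1 else 0) - NN α ^ 2 * (Real.exp 1)⁻¹| ≤ 70 * NN α ^ 2 := by
  have := main_le stein stein_nonneg stein_le hn
  rw [← abs_neg] at this
  convert this using 3
  unfold AA
  have h : NN α ^ 2 * (Real.exp 1)⁻¹ = ∑ σ : Perm α, ∑ τ : Perm α, (Real.exp 1)⁻¹ := by
    rw [sumN, sumN]; ring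
  rw [h, ← Finset.sum_sub_distrib, ← Finset.sum_neg_distrib]
  refine Finset.sum_congr rfl fun σ _ => ?_
  rw [← Finset.sum_sub_distrib, ← Finset.sum_neg_distrib]
  refine Finset.sum_congr rfl fun τ _ => ?_
  have := stein_rec (X σ τ)
  linarith

theorem X_zero_iff (σ τ : Perm α) : X σ τ = 0 ↔ ∀ i, (σ * τ * σ⁻¹ * τ⁻¹) i ≠ i := by
  unfold X
  rw [Finset.card_eq_zero, Finset.filter_eq_empty_iff]
  constructor
  · intro h i hi
    apply h (Finset.mem_univ (σ⁻¹ (τ⁻¹ i)))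
    simpa using hi
  · intro h j _ hj
    apply h (τ (σ j))
    simpa using hj

theorem common_fix (hn : 0 < Fintype.card α) :
    (Fintype.card α : ℝ) * ∑ i : α, AA (fun σ τ : Perm α => I (σ i = i) * I (τ i = i)) = NN α ^ 2 := by
  have hn' : (0:ℝ) < Fintype.card α := by exact_mod_cast hn
  have c1 := cnt1' (α := α)
  set n : ℝ := (Fintype.card α : ℝ) with hnd
  have : ∀ i : α, AA (fun σ τ : Perm α => I (σ i = i) * I (τ i = i)) = (NN α / n) ^ 2 := by
    intro i
    unfold AA
    have : ∑ τ : Perm α, I (τ i = i) = NN α / n := by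
      rw [← c1 i i]; field_simp
    simp only [← Finset.mul_sum, ← Finset.sum_mul, this, sq]
  simp only [this, Finset.sum_const, Finset.card_univ, nsmul_eq_mul, ← hnd]
  field_simp

/-- the event -/
def EV (σ τ : Perm α) : Prop := (∀ i : α, (σ * τ * σ⁻¹ * τ⁻¹) i ≠ i) ∨
            (∀ i : α, (σ * τ * σ⁻¹ * τ⁻¹) i = i → σ i = i ∧ τ i = i)

open Classical in
theorem EV_bounds (hn : 0 < Fintype.card α) :
    AA (fun σ τ : Perm α => if X σ τ = 0 then 1 else 0) ≤ AA (fun σ τ : Perm α => if EV σ τ then 1 else 0) ∧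
    (Fintype.card α : ℝ) * AA (fun σ τ : Perm α => if EV σ τ then 1 else 0) ≤ 
     (Fintype.card α : ℝ) * AA (fun σ τ : Perm α => if X σ τ = 0 then 1 else 0) + NN α ^ 2 := by
  constructor
  · refine Finset.sum_le_sum fun σ _ => Finset.sum_le_sum fun τ _ => ?_
    by_cases h : X σ τ = 0
    · have : EV σ τ := Or.inl ((X_zero_iff σ τ).1 h)
      simp [h, this]
    · simp only [h, if_false]; positivity
  · rw [← common_fix hn, ← mul_add]
    refine mul_le_mul_of_nonneg_left ?_ (by positivity)
    unfold AA
    rw [Finset.sum_comm (s := (Finset.univ : Finset α)), ← Finset.sum_add_distrib]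
    refine Finset.sum_le_sum fun σ _ => ?_
    rw [Finset.sum_comm (s := (Finset.univ : Finset α)), ← Finset.sum_add_distrib]
    refine Finset.sum_le_sum fun τ _ => ?_
    have nn : ∀ i ∈ (Finset.univ : Finset α), 0 ≤ I (σ i = i) * I (τ i = i) := fun i _ => mul_nonneg (I_nonneg _) (I_nonneg _)
    have nn2 := Finset.sum_nonneg nn
    by_cases h : X σ τ = 0
    · simp only [h, if_true]; split_ifs <;> linarith
    · simp only [h, if_false, zero_add]
      by_cases hE : EV σ τ
      · rw [if_pos hE]
        rw [X_zero_iff] at h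
        have h' := h
        push Not at h
        obtain ⟨i, hi⟩ := h
        obtain ⟨a, b⟩ := (hE.resolve_left h') i hi
        refine le_trans ?_ (Finset.single_le_sum nn (Finset.mem_univ i))
        simp [I, a, b]
      · rw [if_neg hE]; exact nn2
end HT

theorem holonomy_torus_probability :
    ∃ C > (0 : ℝ), ∀ n ≥ 1,
      |(Nat.card {p : Equiv.Perm (Fin n) × Equiv.Perm (Fin n) //
            (∀ i : Fin n, (p.1 * p.2 * p.1⁻¹ * p.2⁻¹) i ≠ i) ∨
            (∀ i : Fin n, (p.1 * p.2 * p.1⁻¹ * p.2⁻¹) i = i → p.1 i = i ∧ p.2 i = i)} : ℝ)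
          / (n.factorial : ℝ) ^ 2 - (Real.exp 1)⁻¹| ≤ C / n := by
  classical
  refine ⟨141, by norm_num, fun n hn => ?_⟩
  have hN : HT.NN (Fin n) = n.factorial := by
    rw [← HT.NNcard, Fintype.card_perm, Fintype.card_fin]
  have hcard : (Nat.card {p : Equiv.Perm (Fin n) × Equiv.Perm (Fin n) //
            (∀ i : Fin n, (p.1 * p.2 * p.1⁻¹ * p.2⁻¹) i ≠ i) ∨
            (∀ i : Fin n, (p.1 * p.2 * p.1⁻¹ * p.2⁻¹) i = i → p.1 i = i ∧ p.2 i = i)} : ℝ) =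
      HT.AA (fun σ τ : Perm (Fin n) => if HT.EV σ τ then 1 else 0) := by
    rw [Nat.card_eq_fintype_card, Fintype.card_subtype, Finset.card_filter]
    rw [Nat.cast_sum, ← Finset.univ_product_univ, Finset.sum_product]
    unfold HT.AA
    exact Finset.sum_congr rfl fun σ _ => Finset.sum_congr rfl fun τ _ => by
      beta_reduce
      by_cases h : HT.EV σ τ
      · rw [if_pos h]
        exact (congrArg Nat.cast (if_pos h)).trans Nat.cast_one
      · rw [if_neg h]
        exact (congrArg Nat.cast (if_neg h)).trans Nat.cast_zero
  rw [hcard, ← hN]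
  have hp := HT.NN_pos (α := Fin n)
  have hE := HT.EV_bounds (α := Fin n) (by simpa using Nat.lt_of_lt_of_le Nat.zero_lt_one hn)
  simp only [Fintype.card_fin] at hE
  set E := HT.AA (fun σ τ : Perm (Fin n) => if HT.EV σ τ then 1 else 0)
  set Z := HT.AA (fun σ τ : Perm (Fin n) => if HT.X σ τ = 0 then 1 else 0) with hZ
  set N := HT.NN (Fin n) with hNd
  have hn1 : (1:ℝ) ≤ n := by exact_mod_cast hn
  have e1 : E / N ^ 2 - (Real.exp 1)⁻¹ = (E - N ^ 2 * (Real.exp 1)⁻¹) / N ^ 2 := by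
    field_simp
  rw [e1, abs_div, abs_of_pos (show 0 < N ^ 2 by positivity), div_le_div_iff₀ (by positivity) (by positivity)]
  have tri : |E - N ^ 2 * (Real.exp 1)⁻¹| ≤ (E - Z) + |Z - N ^ 2 * (Real.exp 1)⁻¹| := by
    have := abs_sub_le E Z (N ^ 2 * (Real.exp 1)⁻¹)
    rwa [abs_of_nonneg (show 0 ≤ E - Z by linarith [hE.1])] at this
  have hZb : n * |Z - N ^ 2 * (Real.exp 1)⁻¹| ≤ 140 * N ^ 2 := by
    rcases Nat.lt_or_ge n 2 with h2 | h2
    · have : n = 1 := by omega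
      have hn2 : (n:ℝ) = 1 := by exact_mod_cast this
      have z0 : 0 ≤ Z := Finset.sum_nonneg fun σ _ => Finset.sum_nonneg fun τ _ => by positivity
      have z1 : Z ≤ N ^ 2 := by
        calc Z ≤ ∑ σ : Perm (Fin n), ∑ τ : Perm (Fin n), (1:ℝ) := 
              Finset.sum_le_sum fun σ _ => Finset.sum_le_sum fun τ _ => by beta_reduce; split_ifs <;> norm_num
          _ = _ := by rw [HT.sumN, HT.sumN]; ring
      have i1 : (Real.exp 1)⁻¹ ≤ 1 := inv_le_one_of_one_le₀ (Real.one_le_exp (by norm_num))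
      have i0 : 0 ≤ (Real.exp 1)⁻¹ := by positivity
      rw [hn2, one_mul, abs_le]
      have hp2 : 0 < N ^ 2 := by positivity
      constructor <;> nlinarith
    · have := HT.zero_le (α := Fin n) (by simpa using h2)
      simp only [Fintype.card_fin] at this
      rw [← hZ, ← hNd] at this
      have h2' : (2:ℝ) ≤ n := by exact_mod_cast h2
      nlinarith [abs_nonneg (Z - N ^ 2 * (Real.exp 1)⁻¹)]
  nlinarith [hE.2]
end
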